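/- arXiv:1811.08137 — 2 statements merged into one kernel-verified Lean document; each statement's English description precedes it below -/
import Mathlib

section
/- Martingale van Schaftingen theorem: suppose W satisfies the second structural condition and let p ∈ (1,∞). Then there is a constant C = C(m,ℓ,W,p) such that every F ∈ 𝔚 satisfies, for every N ≥ 1, ‖Σ_{n=1}^N m^{−((p−1)/p)·n}·f_n‖_{L_{p,1}(P)} ≤ C·‖F‖_{L_1} (the Lorentz quasinorm being taken of the pointwise Euclidean norm of the ℝ^ℓ-valued partial sum); that is, I_{(p−1)/p} maps 𝔚 into L_{p,1}. -/
open MeasureTheory ENNReal NNReal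

noncomputable section

namespace MartingaleModel

/-- The cylinder in `ℕ → Fin m` determined by a word `w` of length `n`. -/
def cyl (m n : ℕ) (w : Fin n → Fin m) : Set (ℕ → Fin m) :=
  {x | ∀ i : Fin n, x (i : ℕ) = w i}

/-- `F` is adapted: `F n` depends only on the first `n` coordinates. -/
def AdaptedFun (m : ℕ) {E : Type*} (F : ℕ → (ℕ → Fin m) → E) : Prop :=
  ∀ n (x y : ℕ → Fin m), (∀ i < n, x i = y i) → F n x = F n y

/-- `F` is a martingale for the uniform `m`-adic filtration:
adapted, and each value is the average of the values on the children. -/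
def IsMartingaleFun (m : ℕ) {E : Type*} [AddCommGroup E] [Module ℝ E]
    (F : ℕ → (ℕ → Fin m) → E) : Prop :=
  AdaptedFun m F ∧
    ∀ n (x : ℕ → Fin m), (m : ℝ) • F n x = ∑ j : Fin m, F (n + 1) (Function.update x n j)

/-- Partial sums of the Riesz potential `I_α` applied to the martingale `F`,
`(I_α F)_N = ∑_{n=1}^N m^{-α n} f_n` where `f_n = F_n - F_{n-1}`. -/
def rieszSum (m : ℕ) {E : Type*} [AddCommGroup E] [Module ℝ E] (α : ℝ)
    (F : ℕ → (ℕ → Fin m) → E) (N : ℕ) (x : ℕ → Fin m) : E :=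
  ∑ n ∈ Finset.Icc 1 N, ((m : ℝ) ^ (-(α * n)) : ℝ) • (F n x - F (n - 1) x)

end MartingaleModel

open MartingaleModel

namespace MartingaleModel

/-- The Lorentz `L_{p,1}` quasinorm `‖g‖_{L_{p,1}} = ∫₀^∞ μ({x : ‖g(x)‖ > t})^{1/p} dt`. -/
def lorentzNorm {X : Type*} [MeasurableSpace X] (μ : Measure X) (p : ℝ)
    {E : Type*} [NormedAddCommGroup E] (g : X → E) : ℝ≥0∞ :=
  ∫⁻ t in Set.Ioi (0 : ℝ), (μ {x | t < ‖g x‖}) ^ (1 / p)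

/-- The tuple in `V^ℓ` of values of the martingale difference `f_{n+1}` on the `m`
children of the atom of `ℱ_n` containing `x`. -/
def diffTuple (m : ℕ) {E : Type*} [AddCommGroup E]
    (F : ℕ → (ℕ → Fin m) → E) (n : ℕ) (x : ℕ → Fin m) : Fin m → E :=
  fun j => F (n + 1) (Function.update x n j) - F n x

/-- Membership of a martingale in the Sobolev-type space `𝔚`:
every difference tuple lies in `W`. -/
def MemW (m l : ℕ) (W : Submodule ℝ (Fin m → EuclideanSpace ℝ (Fin l)))
    (F : ℕ → (ℕ → Fin m) → EuclideanSpace ℝ (Fin l)) : Prop :=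
  ∀ (n : ℕ) (x : ℕ → Fin m), diffTuple m F n x ∈ W

/-- The second structural condition: `W` contains no nonzero vector `v ⊗ a` in which
`v` has `m - 1` equal coordinates. -/
def SecondStructural (m l : ℕ) (W : Submodule ℝ (Fin m → EuclideanSpace ℝ (Fin l))) : Prop :=
  ∀ (v : Fin m → ℝ) (a : EuclideanSpace ℝ (Fin l)),
    (∑ j, v j = 0) → (∃ j₀ c, ∀ j, j ≠ j₀ → v j = c) →
    (fun j => v j • a) ∈ W → (fun j => v j • a) = 0

end MartingaleModel

namespace MartingaleModel

/-- For the rank weight `k = μ{f ≤ f(·)}^{-(1-1/p)}`, the sets `{k > s}` satisfy the weak-type bound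
`μ{k > s} ≤ s^{-p/(p-1)}`. -/
lemma measure_rank_weight_gt_le {X : Type*} [MeasurableSpace X] (μ : Measure X)
    [IsProbabilityMeasure μ] {f : X → ℝ} (hfin : (Set.range f).Finite)
    (hpos : ∀ x, 0 < μ.real {y | f x ≤ f y}) {p : ℝ} (hp : 1 < p) {s : ℝ} (hs : 0 < s) :
    μ {x | s < μ.real {y | f x ≤ f y} ^ (-(1 - 1 / p))} ≤
      ENNReal.ofReal (s ^ (-(p / (p - 1)))) := by
  set A := {x | s < μ.real {y | f x ≤ f y} ^ (-(1 - 1 / p))} with hA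
  rcases A.eq_empty_or_nonempty with h | h
  · simp [h]
  have hfA : (f '' A).Finite := hfin.subset (Set.image_subset_range f A)
  obtain ⟨_, ⟨x₀, hx₀, rfl⟩, hmin⟩ := Set.exists_min_image (f '' A) id hfA (h.image f)
  have hsub : A ⊆ {y | f x₀ ≤ f y} := fun x hx => hmin (f x) ⟨x, hx, rfl⟩
  have hp0 : 0 < p - 1 := by linarith
  have hx₀' : s < μ.real {y | f x₀ ≤ f y} ^ (-(1 - 1 / p)) := hx₀
  refine (measure_mono hsub).trans ?_
  rw [← ofReal_measureReal]
  refine ENNReal.ofReal_le_ofReal ?_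
  have h1 : (μ.real {y | f x₀ ≤ f y} ^ (-(1 - 1 / p))) ^ (-(p / (p - 1))) ≤
      s ^ (-(p / (p - 1))) :=
    Real.rpow_le_rpow_of_nonpos hs hx₀'.le (by simp; positivity)
  rwa [← Real.rpow_mul (hpos x₀).le,
    show -(1 - 1 / p) * -(p / (p - 1)) = 1 by field_simp, Real.rpow_one] at h1

lemma lintegral_min_rpow_le {p : ℝ} (hp : 1 < p) {a : ℝ} (ha : 0 < a) :
    ∫⁻ s in Set.Ioi (0 : ℝ), min (ENNReal.ofReal a) (ENNReal.ofReal (s ^ (-(p / (p - 1))))) ≤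
      ENNReal.ofReal (p * a ^ (1 / p)) := by
  set A : ℝ := a ^ (-(1 - 1 / p)) with hA
  have hA0 : 0 < A := Real.rpow_pos_of_pos ha _
  have hp0 : 0 < p - 1 := by linarith
  have he : -(p / (p - 1)) < -1 := by
    rw [neg_lt_neg_iff, lt_div_iff₀ hp0]; linarith
  have hint := integrableOn_Ioi_rpow_of_lt he hA0
  rw [← Set.Ioc_union_Ioi_eq_Ioi hA0.le]
  refine (lintegral_union_le _ _ _).trans ?_
  have h1 : ∫⁻ s in Set.Ioc 0 A, min (ENNReal.ofReal a) (ENNReal.ofReal (s ^ (-(p / (p - 1))))) ≤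
      ENNReal.ofReal (a ^ (1 / p)) := by
    refine (lintegral_mono fun s => min_le_left _ _).trans ?_
    rw [setLIntegral_const, Real.volume_Ioc, sub_zero, ← ENNReal.ofReal_mul ha.le]
    refine ENNReal.ofReal_le_ofReal (le_of_eq ?_)
    rw [hA]
    nth_rewrite 1 [← Real.rpow_one a]
    rw [← Real.rpow_add ha]
    congr 1; ring
  have h2 : ∫⁻ s in Set.Ioi A, min (ENNReal.ofReal a) (ENNReal.ofReal (s ^ (-(p / (p - 1))))) ≤
      ENNReal.ofReal ((p - 1) * a ^ (1 / p)) := by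
    refine (lintegral_mono fun s => min_le_right _ _).trans ?_
    rw [← ofReal_integral_eq_lintegral_ofReal hint
      ((ae_restrict_iff' measurableSet_Ioi).2 (Filter.Eventually.of_forall fun s hs =>
        Real.rpow_nonneg (hA0.le.trans (le_of_lt hs)) _)), integral_Ioi_rpow_of_lt he hA0]
    refine ENNReal.ofReal_le_ofReal (le_of_eq ?_)
    rw [hA, ← Real.rpow_mul ha.le,
      show -(1 - 1 / p) * (-(p / (p - 1)) + 1) = 1 / p by field_simp; ring,
      show -(p / (p - 1)) + 1 = -(1 / (p - 1)) by field_simp; ring]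
    field_simp
  refine (add_le_add h1 h2).trans (le_of_eq ?_)
  rw [← ENNReal.ofReal_add (by positivity) (by positivity)]
  congr 1; ring

/-- A measure that dominates `μ^{1/p}` on the superlevel sets of `f`, and is dominated by
`p μ^{1/p}` on all measurable sets. -/
lemma exists_dominating_measure {X : Type*} [MeasurableSpace X] (μ : Measure X)
    [IsProbabilityMeasure μ] {f : X → ℝ} (hf : Measurable f) (hfin : (Set.range f).Finite)
    (hpos : ∀ x, 0 < μ.real {y | f x ≤ f y}) {p : ℝ} (hp : 1 < p) :
    ∃ ν : Measure X, (∀ t, μ {x | t < f x} ^ (1 / p) ≤ ν {x | t < f x}) ∧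
      ∀ E, MeasurableSet E → ν E ≤ ENNReal.ofReal p * μ E ^ (1 / p) := by
  set k : X → ℝ := fun x => μ.real {y | f x ≤ f y} ^ (-(1 - 1 / p)) with hk
  have hp0 : 0 < p := by linarith
  have he : 0 ≤ 1 - 1 / p := by
    rw [sub_nonneg, div_le_one hp0]; exact hp.le
  have hg : Antitone fun t : ℝ => μ.real {y | t ≤ f y} := fun a b hab =>
    measureReal_mono fun y (hy : b ≤ f y) => hab.trans hy
  have hkm : Measurable k := (hg.measurable.comp hf).pow_const _
  have hk0 : ∀ x, 0 ≤ k x := fun x => Real.rpow_nonneg (hpos x).le _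
  refine ⟨μ.withDensity fun x => ENNReal.ofReal (k x), fun t => ?_, fun E hE => ?_⟩
  · have hm : MeasurableSet {x | t < f x} := measurableSet_lt measurable_const hf
    rw [withDensity_apply _ hm]
    rcases Set.eq_empty_or_nonempty {x | t < f x} with h | ⟨x₁, hx₁⟩
    · rw [h]; simp [hp0]
    have hφ : 0 < μ.real {x | t < f x} :=
      (hpos x₁).trans_le (measureReal_mono fun y (hy : f x₁ ≤ f y) => lt_of_lt_of_le hx₁ hy)
    calc μ {x | t < f x} ^ (1 / p)
        = ENNReal.ofReal (μ.real {x | t < f x} ^ (-(1 - 1 / p))) * μ {x | t < f x} := by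
          rw [← ofReal_measureReal, ENNReal.ofReal_rpow_of_pos hφ,
            ← ENNReal.ofReal_mul (by positivity)]
          congr 1
          nth_rewrite 3 [← Real.rpow_one (μ.real {x | t < f x})]
          rw [← Real.rpow_add hφ]
          congr 1; ring
      _ = ∫⁻ _ in {x | t < f x}, ENNReal.ofReal (μ.real {x | t < f x} ^ (-(1 - 1 / p))) ∂μ := by
          rw [setLIntegral_const]
      _ ≤ _ := by
          refine setLIntegral_mono (by fun_prop) fun x hx => ENNReal.ofReal_le_ofReal ?_
          exact Real.rpow_le_rpow_of_nonpos (hpos x)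
            (measureReal_mono fun y (hy : f x ≤ f y) => lt_of_lt_of_le hx hy) (by linarith)
  · rw [withDensity_apply _ hE, lintegral_eq_lintegral_meas_lt _
      (Filter.Eventually.of_forall hk0) hkm.aemeasurable]
    rcases eq_or_ne (μ E) 0 with h0 | h0
    · simp [Measure.restrict_eq_zero.2 h0]
    have hE0 : 0 < μ.real E := ENNReal.toReal_pos h0 (measure_ne_top _ _)
    rw [← ofReal_measureReal (μ := μ) (s := E), ENNReal.ofReal_rpow_of_pos hE0,
      ← ENNReal.ofReal_mul hp0.le]
    refine le_trans (setLIntegral_mono' measurableSet_Ioi fun s hs => ?_)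
      (lintegral_min_rpow_le hp hE0)
    refine le_min ?_ ((Measure.restrict_apply_le E _).trans
      (measure_rank_weight_gt_le μ hfin hpos hp hs))
    rw [ofReal_measureReal]
    exact (measure_mono (Set.subset_univ _)).trans (by simp)

/-- Finite triangle inequality for the `L_{p,1}` quasinorm, up to the constant `p`. -/
lemma lorentzNorm_le_sum {X E ι : Type*} [MeasurableSpace X] [NormedAddCommGroup E]
    (μ : Measure X) [IsProbabilityMeasure μ] {g : X → E} (hg : Measurable fun x => ‖g x‖)
    (hfin : (Set.range fun x => ‖g x‖).Finite)
    (hpos : ∀ x, 0 < μ.real {y | ‖g x‖ ≤ ‖g y‖}) {p : ℝ} (hp : 1 < p)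
    (s : Finset ι) (h : ι → X → ℝ) (hh : ∀ i ∈ s, Measurable (h i)) (hh0 : ∀ i ∈ s, 0 ≤ h i)
    (hle : ∀ x, ‖g x‖ ≤ ∑ i ∈ s, h i x) :
    lorentzNorm μ p g ≤ ENNReal.ofReal p * ∑ i ∈ s, lorentzNorm μ p (h i) := by
  obtain ⟨ν, hν₁, hν₂⟩ := exists_dominating_measure μ hg hfin hpos hp
  calc lorentzNorm μ p g ≤ ∫⁻ t in Set.Ioi (0 : ℝ), ν {x | t < ‖g x‖} :=
        lintegral_mono fun t => hν₁ t
    _ = ∫⁻ x, ENNReal.ofReal ‖g x‖ ∂ν :=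
        (lintegral_eq_lintegral_meas_lt ν (Filter.Eventually.of_forall fun x => norm_nonneg _)
          hg.aemeasurable).symm
    _ ≤ ∫⁻ x, ∑ i ∈ s, ENNReal.ofReal (h i x) ∂ν := by
        refine lintegral_mono fun x => ?_
        rw [← ENNReal.ofReal_sum_of_nonneg fun i hi => hh0 i hi x]
        exact ENNReal.ofReal_le_ofReal (hle x)
    _ = ∑ i ∈ s, ∫⁻ x, ENNReal.ofReal (h i x) ∂ν :=
        lintegral_finsetSum' s fun i hi => (hh i hi).ennreal_ofReal.aemeasurable
    _ ≤ ∑ i ∈ s, ENNReal.ofReal p * lorentzNorm μ p (h i) := by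
        refine Finset.sum_le_sum fun i hi => ?_
        rw [lintegral_eq_lintegral_meas_lt ν (Filter.Eventually.of_forall (hh0 i hi))
          (hh i hi).aemeasurable, lorentzNorm, ← lintegral_const_mul' _ _ ENNReal.ofReal_ne_top]
        refine lintegral_mono fun t => ?_
        have : {x | t < ‖h i x‖} = {x | t < h i x} := by
          ext x; simp [abs_of_nonneg (hh0 i hi x)]
        rw [this]
        exact hν₂ _ (measurableSet_lt measurable_const (hh i hi))
    _ = _ := by rw [Finset.mul_sum]

/-- `f x` depends only on the first `n` coordinates of `x`. -/
def DependsOnFirst (m n : ℕ) {E : Type*} (f : (ℕ → Fin m) → E) : Prop :=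
  ∀ x y : ℕ → Fin m, (∀ i < n, x i = y i) → f x = f y

/-- The first `n` letters of a sequence. -/
def firstLetters (m n : ℕ) (x : ℕ → Fin m) : Fin n → Fin m := fun i => x i

/-- The extension of a word by zeros. -/
def zeroExtend {m n : ℕ} [NeZero m] (w : Fin n → Fin m) : ℕ → Fin m :=
  fun i => if h : i < n then w ⟨i, h⟩ else 0

lemma measurable_firstLetters (m n : ℕ) : Measurable (firstLetters m n) :=
  measurable_pi_iff.2 fun i => measurable_pi_apply (i : ℕ)

namespace DependsOnFirst

variable {m n : ℕ} {E : Type*} {f : (ℕ → Fin m) → E}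

lemma eq_zeroExtend [NeZero m] (hf : DependsOnFirst m n f) (x : ℕ → Fin m) :
    f x = f (zeroExtend (firstLetters m n x)) :=
  hf _ _ fun i hi => by simp [zeroExtend, firstLetters, hi]

lemma comp {E' : Type*} (hf : DependsOnFirst m n f) (g : E → E') :
    DependsOnFirst m n fun x => g (f x) :=
  fun x y h => congrArg g (hf x y h)

lemma mono {n' : ℕ} (hf : DependsOnFirst m n f) (h : n ≤ n') : DependsOnFirst m n' f :=
  fun x y hxy => hf x y fun i hi => hxy i (hi.trans_le h)

lemma update (hf : DependsOnFirst m (n + 1) f) (j : Fin m) :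
    DependsOnFirst m n fun x => f (Function.update x n j) := by
  refine fun x y h => hf _ _ fun i hi => ?_
  rcases (Nat.lt_succ_iff_lt_or_eq.1 hi) with h' | rfl
  · rw [Function.update_of_ne h'.ne, Function.update_of_ne h'.ne, h i h']
  · simp

lemma finite_range [NeZero m] (hf : DependsOnFirst m n f) : (Set.range f).Finite := by
  refine (Set.finite_range fun w : Fin n → Fin m => f (zeroExtend w)).subset ?_
  rintro _ ⟨x, rfl⟩
  exact ⟨firstLetters m n x, (hf.eq_zeroExtend x).symm⟩

lemma measurable [NeZero m] [MeasurableSpace E] (hf : DependsOnFirst m n f) : Measurable f := by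
  have : f = (fun w : Fin n → Fin m => f (zeroExtend w)) ∘ firstLetters m n :=
    funext hf.eq_zeroExtend
  rw [this]
  exact (Measurable.of_discrete).comp (measurable_firstLetters m n)

end DependsOnFirst

/-- `P` is the uniform product measure. -/
def IsUniform (m : ℕ) (P : Measure (ℕ → Fin m)) : Prop :=
  ∀ (n : ℕ) (w : Fin n → Fin m), P (cyl m n w) = ((m : ℝ≥0∞))⁻¹ ^ n

lemma measureReal_superlevel_pos {m n : ℕ} {P : Measure (ℕ → Fin m)}
    [IsProbabilityMeasure P] (hP : IsUniform m P) {f : (ℕ → Fin m) → ℝ}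
    (hf : DependsOnFirst m n f) (x : ℕ → Fin m) :
    0 < P.real {y | f x ≤ f y} := by
  have hsub : cyl m n (firstLetters m n x) ⊆ {y | f x ≤ f y} := fun y hy =>
    (hf x y fun i hi => (hy ⟨i, hi⟩).symm).le
  have h : 0 < P (cyl m n (firstLetters m n x)) := by
    rw [hP]
    exact ENNReal.pow_pos (ENNReal.inv_pos.2 (ENNReal.natCast_ne_top m)) n
  exact ENNReal.toReal_pos (h.trans_le (measure_mono hsub)).ne' (measure_ne_top _ _)

section Uniform

variable {m n : ℕ} [NeZero m] {P : Measure (ℕ → Fin m)}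

lemma lintegral_eq_sum (hP : IsUniform m P) {f : (ℕ → Fin m) → ℝ≥0∞}
    (hf : DependsOnFirst m n f) :
    ∫⁻ x, f x ∂P = ∑ w : Fin n → Fin m, f (zeroExtend w) * (m : ℝ≥0∞)⁻¹ ^ n := by
  calc ∫⁻ x, f x ∂P = ∫⁻ x, f (zeroExtend (firstLetters m n x)) ∂P :=
        lintegral_congr hf.eq_zeroExtend
    _ = ∫⁻ w, f (zeroExtend w) ∂(P.map (firstLetters m n)) :=
        (lintegral_map (f := fun w : Fin n → Fin m => f (zeroExtend w)) .of_discrete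
          (measurable_firstLetters m n)).symm
    _ = _ := by
        rw [lintegral_fintype]
        refine Finset.sum_congr rfl fun w _ => ?_
        rw [Measure.map_apply (measurable_firstLetters m n) (measurableSet_singleton w), ← hP n w]
        congr 2
        ext x
        simp [cyl, firstLetters, funext_iff]

lemma le_pow_mul_lintegral (hP : IsUniform m P) {f : (ℕ → Fin m) → ℝ≥0∞}
    (hf : DependsOnFirst m n f) (x : ℕ → Fin m) : f x ≤ (m : ℝ≥0∞) ^ n * ∫⁻ x, f x ∂P := by
  rw [lintegral_eq_sum hP hf, ← Finset.sum_mul, mul_comm, mul_assoc, ← mul_pow,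
    ENNReal.inv_mul_cancel (by exact_mod_cast NeZero.ne m) (ENNReal.natCast_ne_top m), one_pow,
    mul_one, hf.eq_zeroExtend x]
  exact Finset.single_le_sum (f := fun w : Fin n → Fin m => f (zeroExtend w))
    (fun _ _ => zero_le) (Finset.mem_univ _)

lemma lintegral_ne_top (hP : IsUniform m P) {f : (ℕ → Fin m) → ℝ≥0∞}
    (hf : DependsOnFirst m n f) (hfin : ∀ x, f x ≠ ⊤) : ∫⁻ x, f x ∂P ≠ ⊤ := by
  rw [lintegral_eq_sum hP hf]
  exact ENNReal.sum_ne_top.2 fun w _ => ENNReal.mul_ne_top (hfin _)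
    (ENNReal.pow_ne_top (ENNReal.inv_ne_top.2 (by exact_mod_cast NeZero.ne m)))

/-- Tower property for the uniform measure. -/
lemma lintegral_average (hP : IsUniform m P) {f : (ℕ → Fin m) → ℝ≥0∞}
    (hf : DependsOnFirst m (n + 1) f) :
    ∫⁻ x, (m : ℝ≥0∞)⁻¹ * ∑ j : Fin m, f (Function.update x n j) ∂P = ∫⁻ x, f x ∂P := by
  have hD : DependsOnFirst m n fun x => (m : ℝ≥0∞)⁻¹ * ∑ j : Fin m, f (Function.update x n j) :=
    fun x y h => by simp only [fun j => hf.update j x y h]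
  rw [lintegral_eq_sum hP hD, lintegral_eq_sum hP hf,
    ← (Fin.snocEquiv fun _ : Fin (n + 1) => Fin m).sum_comp, Fintype.sum_prod_type_right]
  refine Finset.sum_congr rfl fun w _ => ?_
  rw [Finset.mul_sum, Finset.sum_mul]
  refine Finset.sum_congr rfl fun j _ => ?_
  have : f (Function.update (zeroExtend w) n j) =
      f (zeroExtend (Fin.snocEquiv (fun _ : Fin (n + 1) => Fin m) (j, w))) := by
    refine hf _ _ fun i hi => ?_
    rcases (Nat.lt_succ_iff_lt_or_eq.1 hi) with h' | rfl
    · rw [Function.update_of_ne h'.ne]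
      simp [zeroExtend, h', hi, Fin.snocEquiv, Fin.snoc]
    · simp [zeroExtend, Fin.snocEquiv, Fin.snoc]
  rw [this, pow_succ]
  ring

/-- On functions of the first `n` coordinates, `L_q` embeds into `L_{p,1}` for `q < p`, with norm
growing like `m^{n(1/q-1/p)}`. -/
lemma lorentzNorm_le_of_dependsOnFirst [IsProbabilityMeasure P] (hP : IsUniform m P)
    {h : (ℕ → Fin m) → ℝ} (hh : DependsOnFirst m n h) {p q : ℝ} (hq : 0 < q) (hqp : q < p) :
    lorentzNorm P p h ≤ ENNReal.ofReal (1 - q / p)⁻¹ *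
      ((m : ℝ≥0∞) ^ ((n : ℝ) * (1 / q - 1 / p)) * (∫⁻ x, ‖h x‖ₑ ^ q ∂P) ^ (1 / q)) := by
  have hp : 0 < p := hq.trans hqp
  have hm : (0 : ℝ) < m := by exact_mod_cast NeZero.pos m
  have hr : 0 < 1 - q / p := by rw [sub_pos, div_lt_one hp]; exact hqp
  have hhq : DependsOnFirst m n fun x => ‖h x‖ₑ ^ q := hh.comp fun t => ‖t‖ₑ ^ q
  have hBfin : ∫⁻ x, ‖h x‖ₑ ^ q ∂P ≠ ⊤ :=
    lintegral_ne_top hP hhq fun x => ENNReal.rpow_ne_top_of_nonneg hq.le (by simp)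
  obtain ⟨b, hb0, hb⟩ : ∃ b : ℝ, 0 ≤ b ∧ ∫⁻ x, ‖h x‖ₑ ^ q ∂P = ENNReal.ofReal (b ^ q) := by
    refine ⟨(∫⁻ x, ‖h x‖ₑ ^ q ∂P).toReal ^ (1 / q), by positivity, ?_⟩
    rw [← Real.rpow_mul ENNReal.toReal_nonneg, one_div_mul_cancel hq.ne', Real.rpow_one,
      ENNReal.ofReal_toReal hBfin]
  set T : ℝ := (m : ℝ) ^ ((n : ℝ) / q) * b with hT
  have hT0 : 0 ≤ T := by positivity
  have hsup : ∀ x, ‖h x‖ ≤ T := by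
    intro x
    have h1 := le_pow_mul_lintegral hP hhq x
    rw [hb, ← ofReal_norm, ENNReal.ofReal_rpow_of_nonneg (norm_nonneg _) hq.le,
      ← ENNReal.ofReal_natCast, ← ENNReal.ofReal_pow hm.le, ← ENNReal.ofReal_mul (by positivity),
      ENNReal.ofReal_le_ofReal_iff (by positivity)] at h1
    rw [← Real.rpow_le_rpow_iff (norm_nonneg _) hT0 hq, hT, Real.mul_rpow (by positivity) hb0,
      ← Real.rpow_mul hm.le, div_mul_cancel₀ _ hq.ne', Real.rpow_natCast]
    exact h1
  have hweak : ∀ t : ℝ, 0 < t → P {x | t < ‖h x‖} ≤ ENNReal.ofReal (b ^ q * t ^ (-q)) := by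
    intro t ht
    have h1 := mul_meas_ge_le_lintegral (μ := P) hhq.measurable (ENNReal.ofReal (t ^ q))
    rw [hb] at h1
    have hsub : {x | t < ‖h x‖} ⊆ {x | ENNReal.ofReal (t ^ q) ≤ ‖h x‖ₑ ^ q} := by
      intro x (hx : t < ‖h x‖)
      rw [Set.mem_ofPred_eq, ← ofReal_norm, ENNReal.ofReal_rpow_of_nonneg (norm_nonneg _) hq.le]
      exact ENNReal.ofReal_le_ofReal (Real.rpow_le_rpow ht.le hx.le hq.le)
    refine (measure_mono hsub).trans ?_
    rw [Real.rpow_neg ht.le, ← div_eq_mul_inv, ENNReal.ofReal_div_of_pos (by positivity),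
      ENNReal.le_div_iff_mul_le (Or.inl (by simp; positivity)) (Or.inl ENNReal.ofReal_ne_top),
      mul_comm]
    exact h1
  have hexp : -1 < -(q / p) := by linarith
  have hint : IntervalIntegrable (fun t : ℝ => b ^ (q / p) * t ^ (-(q / p))) volume 0 T :=
    (intervalIntegral.intervalIntegrable_rpow' hexp).const_mul _
  calc lorentzNorm P p h
      ≤ ∫⁻ t in Set.Ioc 0 T, ENNReal.ofReal (b ^ (q / p) * t ^ (-(q / p))) := by
        rw [lorentzNorm, ← Set.Ioc_union_Ioi_eq_Ioi hT0]
        refine (lintegral_union_le _ _ _).trans ?_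
        have h0 : ∫⁻ t in Set.Ioi T, P {x | t < ‖h x‖} ^ (1 / p) = 0 := by
          rw [setLIntegral_congr_fun (g := fun _ => 0) measurableSet_Ioi, lintegral_zero]
          intro t (ht : T < t)
          have : {x | t < ‖h x‖} = ∅ :=
            Set.eq_empty_of_forall_notMem fun x (hx : t < ‖h x‖) =>
              absurd (hsup x) (not_le.2 (ht.trans hx))
          change P {x | t < ‖h x‖} ^ (1 / p) = 0
          rw [this]
          simp [hp]
        rw [h0, add_zero]
        refine setLIntegral_mono' measurableSet_Ioc fun t ht => ?_
        refine (ENNReal.rpow_le_rpow (hweak t ht.1) (by positivity)).trans (le_of_eq ?_)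
        have ht0 := ht.1.le
        rw [ENNReal.ofReal_rpow_of_nonneg (by positivity) (by positivity),
          Real.mul_rpow (by positivity) (by positivity), ← Real.rpow_mul hb0, ← Real.rpow_mul ht0]
        congr 3 <;> ring
    _ = ENNReal.ofReal (b ^ (q / p) * (T ^ (1 - q / p) / (1 - q / p))) := by
        rw [← ofReal_integral_eq_lintegral_ofReal
          ((intervalIntegrable_iff_integrableOn_Ioc_of_le hT0).1 hint)
          ((ae_restrict_iff' measurableSet_Ioc).2 (Filter.Eventually.of_forall fun t ht =>
            mul_nonneg (by positivity) (Real.rpow_nonneg ht.1.le _))),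
          ← intervalIntegral.integral_of_le hT0, intervalIntegral.integral_const_mul,
          integral_rpow (Or.inl hexp), show -(q / p) + 1 = 1 - q / p by ring,
          Real.zero_rpow hr.ne', sub_zero]
    _ = _ := by
        rw [hb, ENNReal.ofReal_rpow_of_nonneg (by positivity) (by positivity), ← Real.rpow_mul hb0,
          mul_one_div_cancel hq.ne', Real.rpow_one, ← ENNReal.ofReal_natCast,
          ENNReal.ofReal_rpow_of_pos hm, ← ENNReal.ofReal_mul (by positivity),
          ← ENNReal.ofReal_mul (by positivity)]
        congr 1
        rw [hT, Real.mul_rpow (by positivity) hb0, ← Real.rpow_mul hm.le,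
          show (n : ℝ) / q * (1 - q / p) = n * (1 / q - 1 / p) by field_simp]
        have hbb : b ^ (q / p) * b ^ (1 - q / p) = b := by
          rw [← Real.rpow_add_of_nonneg hb0 (by positivity) hr.le,
            show q / p + (1 - q / p) = 1 by ring, Real.rpow_one]
        calc _ = (b ^ (q / p) * b ^ (1 - q / p)) *
              ((m : ℝ) ^ ((n : ℝ) * (1 / q - 1 / p)) / (1 - q / p)) := by ring
          _ = _ := by rw [hbb]; ring

end Uniform

/-- The average of `f` over the children of the atom of level `n` containing `x`. -/
def childAverage (m n : ℕ) (f : (ℕ → Fin m) → ℝ≥0∞) (x : ℕ → Fin m) : ℝ≥0∞ :=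
  (m : ℝ≥0∞)⁻¹ * ∑ j : Fin m, f (Function.update x n j)

lemma DependsOnFirst.childAverage {m n : ℕ} {f : (ℕ → Fin m) → ℝ≥0∞}
    (hf : DependsOnFirst m (n + 1) f) :
    DependsOnFirst m n (childAverage m n f) :=
  fun x y h => by simp only [MartingaleModel.childAverage, fun j => hf.update j x y h]

section Growth

variable {m n : ℕ} [NeZero m] {P : Measure (ℕ → Fin m)}

lemma rpow_eq_rpow_sub_one_mul (a : ℝ≥0∞) {q : ℝ} (hq : 1 ≤ q) : a ^ q = a ^ (q - 1) * a := by
  nth_rewrite 3 [← ENNReal.rpow_one a]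
  rw [← ENNReal.rpow_add_of_nonneg _ _ (by linarith) zero_le_one]
  congr 1; ring

lemma lintegral_rpow_le_of_dependsOnFirst (hP : IsUniform m P) {f : (ℕ → Fin m) → ℝ≥0∞}
    (hf : DependsOnFirst m n f) {q : ℝ} (hq : 1 < q) :
    (∫⁻ x, f x ^ q ∂P) ^ (1 / q) ≤ (m : ℝ≥0∞) ^ ((n : ℝ) * (1 - 1 / q)) * ∫⁻ x, f x ∂P := by
  have hq0 : 0 < q := by linarith
  have hq1 : 0 ≤ q - 1 := by linarith
  set I := ∫⁻ x, f x ∂P with hI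
  have h1 : ∫⁻ x, f x ^ q ∂P ≤ (((m : ℝ≥0∞) ^ n * I) ^ (q - 1)) * I := by
    rw [hI, ← lintegral_const_mul _ hf.measurable]
    refine lintegral_mono fun x => ?_
    rw [rpow_eq_rpow_sub_one_mul _ hq.le]
    gcongr
    exact le_pow_mul_lintegral hP hf x
  refine (ENNReal.rpow_le_rpow h1 (by positivity)).trans (le_of_eq ?_)
  rw [ENNReal.mul_rpow_of_nonneg _ _ hq1, mul_assoc, ← rpow_eq_rpow_sub_one_mul _ hq.le,
    ENNReal.mul_rpow_of_nonneg _ _ (by positivity), ← ENNReal.rpow_mul,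
    ← ENNReal.rpow_mul, mul_one_div_cancel hq0.ne', ENNReal.rpow_one, ← ENNReal.rpow_natCast,
    ← ENNReal.rpow_mul]
  congr 2
  field_simp

lemma sum_rpow_le_of_le_mul_sum {ι : Type*} (s : Finset ι) {c : ι → ℝ≥0∞} {ρ : ℝ≥0∞}
    (hc : ∀ j ∈ s, c j ≤ ρ * ∑ i ∈ s, c i) {q : ℝ} (hq : 1 < q) :
    ∑ j ∈ s, c j ^ q ≤ ρ ^ (q - 1) * (∑ i ∈ s, c i) ^ q := by
  set S := ∑ i ∈ s, c i with hS
  have hq1 : 0 ≤ q - 1 := by linarith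
  calc ∑ j ∈ s, c j ^ q ≤ ∑ j ∈ s, (ρ * S) ^ (q - 1) * c j := by
        refine Finset.sum_le_sum fun j hj => ?_
        rw [rpow_eq_rpow_sub_one_mul _ hq.le]
        gcongr
        exact hc j hj
    _ = ρ ^ (q - 1) * S ^ q := by
        rw [← Finset.mul_sum, ← hS, ENNReal.mul_rpow_of_nonneg _ _ hq1, mul_assoc,
          ← rpow_eq_rpow_sub_one_mul _ hq.le]

/-- If no child carries more than a fraction `ρ` of the mass of an atom, then the `L_q` norm grows
by a factor strictly smaller than the extremal one. -/
lemma lintegral_rpow_succ_le (hP : IsUniform m P) {f : (ℕ → Fin m) → ℝ≥0∞}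
    (hf : DependsOnFirst m (n + 1) f) {ρ : ℝ≥0∞}
    (hρ : ∀ x j, f (Function.update x n j) ≤ ρ * ∑ i, f (Function.update x n i))
    {q : ℝ} (hq : 1 < q) :
    (∫⁻ x, f x ^ q ∂P) ^ (1 / q) ≤ ρ ^ (1 - 1 / q) * ((m : ℝ≥0∞) ^ (1 - 1 / q) *
      (∫⁻ x, childAverage m n f x ^ q ∂P) ^ (1 / q)) := by
  have hq0 : 0 < q := by linarith
  have hm0 : (m : ℝ≥0∞) ≠ 0 := by exact_mod_cast NeZero.ne m
  have hmt : (m : ℝ≥0∞) ≠ ⊤ := ENNReal.natCast_ne_top m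
  have h1 : ∫⁻ x, f x ^ q ∂P ≤
      ρ ^ (q - 1) * ((m : ℝ≥0∞) ^ (q - 1) * ∫⁻ x, childAverage m n f x ^ q ∂P) := by
    have hmeas : Measurable fun x => childAverage m n f x ^ q :=
      (hf.childAverage.comp fun t => t ^ q).measurable
    rw [← lintegral_average hP (hf.comp fun t => t ^ q), ← lintegral_const_mul _ hmeas,
      ← lintegral_const_mul _ (hmeas.const_mul _)]
    refine lintegral_mono fun x => ?_
    refine (mul_le_mul_right (sum_rpow_le_of_le_mul_sum Finset.univ
      (fun j _ => hρ x j) hq) _).trans (le_of_eq ?_)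
    rw [childAverage, ENNReal.mul_rpow_of_nonneg _ _ hq0.le, ENNReal.inv_rpow, ← ENNReal.rpow_neg]
    have : (m : ℝ≥0∞)⁻¹ = (m : ℝ≥0∞) ^ (q - 1) * (m : ℝ≥0∞) ^ (-q) := by
      rw [← ENNReal.rpow_add _ _ hm0 hmt, ← ENNReal.rpow_neg_one]
      congr 1; ring
    rw [this]
    ring
  refine (ENNReal.rpow_le_rpow h1 (by positivity)).trans (le_of_eq ?_)
  rw [ENNReal.mul_rpow_of_nonneg _ _ (by positivity),
    ENNReal.mul_rpow_of_nonneg _ _ (by positivity), ← ENNReal.rpow_mul, ← ENNReal.rpow_mul,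
    show (q - 1) * (1 / q) = 1 - 1 / q by field_simp]

/-- Summability of the normalized `L_q` norms along a nonnegative submartingale whose mass
spreads at every step. -/
lemma sum_normalized_Lq_le [IsProbabilityMeasure P] (hP : IsUniform m P)
    {u : ℕ → (ℕ → Fin m) → ℝ≥0∞}
    (hu : ∀ n, DependsOnFirst m n (u n)) (hsub : ∀ n x, u n x ≤ childAverage m n (u (n + 1)) x)
    {ρ : ℝ≥0∞} (hρ : ∀ n x j, u (n + 1) (Function.update x n j) ≤
      ρ * ∑ i, u (n + 1) (Function.update x n i))
    {q : ℝ} (hq : 1 < q) {κ : ℝ≥0∞} (hκ : 1 + κ * ρ ^ (1 - 1 / q) ≤ κ) (N : ℕ) :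
    ∑ n ∈ Finset.range N,
        (m : ℝ≥0∞) ^ (-((n : ℝ) * (1 - 1 / q))) * (∫⁻ x, u n x ^ q ∂P) ^ (1 / q) ≤
      κ * ∫⁻ x, u N x ∂P := by
  have hq0 : 0 < q := by linarith
  have hm0 : (m : ℝ≥0∞) ≠ 0 := by exact_mod_cast NeZero.ne m
  have hmt : (m : ℝ≥0∞) ≠ ⊤ := ENNReal.natCast_ne_top m
  set b : ℕ → ℝ≥0∞ := fun n =>
    (m : ℝ≥0∞) ^ (-((n : ℝ) * (1 - 1 / q))) * (∫⁻ x, u n x ^ q ∂P) ^ (1 / q) with hb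
  set g : ℕ → (ℕ → Fin m) → ℝ≥0∞ := fun n x => childAverage m n (u (n + 1)) x - u n x with hg
  have hg_dep : ∀ n, DependsOnFirst m n (g n) := fun n x y h => by
    simp only [hg, (hu (n + 1)).childAverage x y h, hu n x y h]
  have hadd : ∀ n x, childAverage m n (u (n + 1)) x = u n x + g n x := fun n x =>
    (add_tsub_cancel_of_le (hsub n x)).symm
  have hmass : ∀ n, ∫⁻ x, u (n + 1) x ∂P = ∫⁻ x, u n x ∂P + ∫⁻ x, g n x ∂P := fun n => by
    rw [← lintegral_average hP (hu (n + 1)), ← lintegral_add_left (hu n).measurable]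
    exact lintegral_congr (hadd n)
  have hrec : ∀ n, b (n + 1) ≤ ρ ^ (1 - 1 / q) * (b n + ∫⁻ x, g n x ∂P) := by
    intro n
    have h1 := lintegral_rpow_succ_le hP (hu (n + 1)) (hρ n) hq
    have h2 : (∫⁻ x, childAverage m n (u (n + 1)) x ^ q ∂P) ^ (1 / q) ≤
        (∫⁻ x, u n x ^ q ∂P) ^ (1 / q) +
          (m : ℝ≥0∞) ^ ((n : ℝ) * (1 - 1 / q)) * ∫⁻ x, g n x ∂P := by
      simp only [hadd]
      exact (ENNReal.lintegral_Lp_add_le (hu n).measurable.aemeasurable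
        (hg_dep n).measurable.aemeasurable hq.le).trans
        (add_le_add le_rfl (lintegral_rpow_le_of_dependsOnFirst hP (hg_dep n) hq))
    have h3 : (m : ℝ≥0∞) ^ (-(((n + 1 : ℕ) : ℝ) * (1 - 1 / q))) * (m : ℝ≥0∞) ^ (1 - 1 / q) =
        (m : ℝ≥0∞) ^ (-((n : ℝ) * (1 - 1 / q))) := by
      rw [← ENNReal.rpow_add _ _ hm0 hmt]
      congr 1; push_cast; ring
    have h4 : (m : ℝ≥0∞) ^ (-((n : ℝ) * (1 - 1 / q))) * (m : ℝ≥0∞) ^ ((n : ℝ) * (1 - 1 / q)) =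
        1 := by
      rw [← ENNReal.rpow_add _ _ hm0 hmt, neg_add_cancel, ENNReal.rpow_zero]
    calc b (n + 1) ≤ (m : ℝ≥0∞) ^ (-(((n + 1 : ℕ) : ℝ) * (1 - 1 / q))) * (ρ ^ (1 - 1 / q) *
          ((m : ℝ≥0∞) ^ (1 - 1 / q) * ((∫⁻ x, u n x ^ q ∂P) ^ (1 / q) +
          (m : ℝ≥0∞) ^ ((n : ℝ) * (1 - 1 / q)) * ∫⁻ x, g n x ∂P))) := by
          simp only [hb]
          gcongr
          refine h1.trans ?_
          gcongr
      _ = ρ ^ (1 - 1 / q) * (((m : ℝ≥0∞) ^ (-(((n + 1 : ℕ) : ℝ) * (1 - 1 / q))) *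
          (m : ℝ≥0∞) ^ (1 - 1 / q)) * ((∫⁻ x, u n x ^ q ∂P) ^ (1 / q) +
          (m : ℝ≥0∞) ^ ((n : ℝ) * (1 - 1 / q)) * ∫⁻ x, g n x ∂P)) := by ring
      _ = _ := by rw [h3, mul_add, ← mul_assoc ((m : ℝ≥0∞) ^ (-((n : ℝ) * (1 - 1 / q)))),
          h4, one_mul]
  have hmain : ∀ N, ∑ n ∈ Finset.range N, b n + κ * b N ≤ κ * ∫⁻ x, u N x ∂P := by
    intro N
    induction N with
    | zero =>
      have h0 := lintegral_rpow_le_of_dependsOnFirst hP (hu 0) hq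
      simp only [Nat.cast_zero, zero_mul, ENNReal.rpow_zero, one_mul] at h0
      simp only [hb, Finset.range_zero, Finset.sum_empty, zero_add, Nat.cast_zero, zero_mul,
        neg_zero, ENNReal.rpow_zero, one_mul]
      gcongr
    | succ N ih =>
      have hκ' : κ * ρ ^ (1 - 1 / q) ≤ κ := le_add_self.trans hκ
      calc ∑ n ∈ Finset.range (N + 1), b n + κ * b (N + 1)
          ≤ ∑ n ∈ Finset.range N, b n + b N +
              κ * (ρ ^ (1 - 1 / q) * (b N + ∫⁻ x, g N x ∂P)) := by
            rw [Finset.sum_range_succ]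
            gcongr
            exact hrec N
        _ = ∑ n ∈ Finset.range N, b n + (1 + κ * ρ ^ (1 - 1 / q)) * b N +
              κ * ρ ^ (1 - 1 / q) * ∫⁻ x, g N x ∂P := by ring
        _ ≤ ∑ n ∈ Finset.range N, b n + κ * b N + κ * ∫⁻ x, g N x ∂P := by gcongr
        _ ≤ κ * ∫⁻ x, u N x ∂P + κ * ∫⁻ x, g N x ∂P := by gcongr
        _ = κ * ∫⁻ x, u (N + 1) x ∂P := by rw [hmass, mul_add]
  exact le_self_add.trans (hmain N)

end Growth

/-- The second structural condition prevents the mass of an atom from passing to a single child. -/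
lemma SecondStructural.exists_lt_one {m l : ℕ} (hm : 2 ≤ m)
    {W : Submodule ℝ (Fin m → EuclideanSpace ℝ (Fin l))}
    (hWV : ∀ b ∈ W, ∑ j : Fin m, b j = 0) (hW : SecondStructural m l W) :
    ∃ ρ : ℝ≥0, ρ < 1 ∧ ∀ (a : EuclideanSpace ℝ (Fin l)) (c : Fin m → EuclideanSpace ℝ (Fin l)),
      (fun j => c j - a) ∈ W → ∀ j, ‖c j‖ₑ ≤ ρ * ∑ i, ‖c i‖ₑ := by
  let const : EuclideanSpace ℝ (Fin l) →ₗ[ℝ] (Fin m → EuclideanSpace ℝ (Fin l)) :=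
    LinearMap.pi fun _ => LinearMap.id
  let U : Submodule ℝ (Fin m → EuclideanSpace ℝ (Fin l)) := W ⊔ LinearMap.range const
  have hU : ∀ c ∈ U, ∃ a, (fun j => c j - a) ∈ W := by
    intro c hc
    obtain ⟨b, hb, _, ⟨a, rfl⟩, rfl⟩ := Submodule.mem_sup.1 hc
    exact ⟨a, by convert hb using 1; ext j; simp [const]⟩
  have hU' : ∀ c a, (fun j => c j - a) ∈ W → c ∈ U := fun c a h =>
    Submodule.mem_sup.2 ⟨_, h, _, ⟨a, rfl⟩, by ext j; simp [const]⟩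
  have hm0 : (m : ℝ) ≠ 0 := by exact_mod_cast (by omega : m ≠ 0)
  have hinj : ∀ j₀ : Fin m, ∀ c ∈ U, (∀ j, j ≠ j₀ → c j = 0) → c = 0 := by
    intro j₀ c hc hz
    obtain ⟨a, ha⟩ := hU c hc
    have hsum := hWV _ ha
    rw [Finset.sum_sub_distrib, Finset.sum_eq_single j₀ (fun j _ hj => hz j hj) (by simp),
      Finset.sum_const, Finset.card_univ, Fintype.card_fin, sub_eq_zero,
      ← Nat.cast_smul_eq_nsmul ℝ] at hsum
    have hv := hW (fun j => (if j = j₀ then (m : ℝ) else 0) - 1) a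
      (by simp [Finset.sum_sub_distrib])
      ⟨j₀, -1, fun j hj => by simp [hj]⟩
      (by
        convert ha using 1
        ext1 j
        by_cases hj : j = j₀
        · subst hj; simp [hsum, sub_smul]
        · simp [hj, hz j hj])
    have : Nontrivial (Fin m) := Fin.nontrivial_iff_two_le.2 hm
    obtain ⟨j₁, hj₁⟩ := exists_ne j₀
    have ha0 : a = 0 := by simpa [hj₁] using congrFun hv j₁
    ext1 j
    by_cases hj : j = j₀
    · subst hj; simp [hsum, ha0]
    · exact hz j hj
  have hK : ∀ j₀ : Fin m, ∃ K : ℝ≥0, ∀ c ∈ U, ‖c j₀‖₊ ≤ K * ∑ i ∈ Finset.univ.erase j₀, ‖c i‖₊ := by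
    intro j₀
    let L : U →ₗ[ℝ] ({j : Fin m // j ≠ j₀} → EuclideanSpace ℝ (Fin l)) :=
      LinearMap.pi fun j => (LinearMap.proj (j : Fin m)).comp U.subtype
    have hL : LinearMap.ker L = ⊥ := by
      refine LinearMap.ker_eq_bot'.2 fun c hc => Subtype.ext (hinj j₀ c c.2 fun j hj => ?_)
      exact congrFun hc ⟨j, hj⟩
    obtain ⟨K, -, hK⟩ := L.exists_antilipschitzWith hL
    refine ⟨K, fun c hc => ?_⟩
    have h1 : ‖c‖₊ ≤ K * ‖L ⟨c, hc⟩‖₊ := by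
      have := hK.le_mul_nndist ⟨c, hc⟩ 0
      rwa [nndist_zero_right, map_zero, nndist_zero_right] at this
    refine (nnnorm_le_pi_nnnorm c j₀).trans (h1.trans ?_)
    gcongr
    refine pi_nnnorm_le_iff.2 fun j => ?_
    exact Finset.single_le_sum (f := fun i => ‖c i‖₊) (fun _ _ => zero_le)
      (Finset.mem_erase.2 ⟨j.2, Finset.mem_univ _⟩)
  choose K hK using hK
  set M : ℝ≥0 := ∑ j, K j with hM
  refine ⟨M / (1 + M), by rw [div_lt_one (by positivity)]; exact lt_one_add M, fun a c hc j => ?_⟩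
  have h1 : ‖c j‖₊ ≤ M * ∑ i ∈ Finset.univ.erase j, ‖c i‖₊ :=
    (hK j c (hU' c a hc)).trans (by
      gcongr
      exact Finset.single_le_sum (fun _ _ => zero_le) (Finset.mem_univ j))
  have h2 : ‖c j‖₊ ≤ M / (1 + M) * ∑ i, ‖c i‖₊ := by
    rw [← Finset.add_sum_erase _ _ (Finset.mem_univ j), div_mul_eq_mul_div,
      le_div_iff₀ (by positivity)]
    calc ‖c j‖₊ * (1 + M) = M * ‖c j‖₊ + ‖c j‖₊ := by ring
      _ ≤ M * ‖c j‖₊ + M * ∑ i ∈ Finset.univ.erase j, ‖c i‖₊ := by gcongr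
      _ = _ := by ring
  simp only [enorm_eq_nnnorm]
  exact_mod_cast h2

end MartingaleModel

/-- **Martingale van Schaftingen theorem.** If the subspace `W ⊆ V^ℓ` satisfies the
second structural condition and `p ∈ (1,∞)`, then there is `C = C(m,ℓ,W,p)` such that
every `F ∈ 𝔚` satisfies `‖∑_{n=1}^N m^{-((p-1)/p)n} f_n‖_{L_{p,1}(P)} ≤ C·‖F‖_{L_1}`
for every `N ≥ 1`; that is, `I_{(p-1)/p}` maps `𝔚` into `L_{p,1}`. -/
theorem martingale_van_schaftingen (m l : ℕ) (hm : 3 ≤ m) (hl : 1 ≤ l)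
    (P : Measure (ℕ → Fin m)) (hP : IsProbabilityMeasure P)
    (hPcyl : ∀ (n : ℕ) (w : Fin n → Fin m), P (cyl m n w) = ((m : ℝ≥0∞))⁻¹ ^ n)
    (W : Submodule ℝ (Fin m → EuclideanSpace ℝ (Fin l)))
    (hWV : ∀ b ∈ W, ∑ j : Fin m, b j = 0)
    (hW : SecondStructural m l W) (p : ℝ) (hp : 1 < p) :
    ∃ C : ℝ≥0, ∀ F : ℕ → (ℕ → Fin m) → EuclideanSpace ℝ (Fin l),
      IsMartingaleFun m F → (⨆ n, eLpNorm (F n) 1 P) < ⊤ → MemW m l W F →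
      ∀ N, 1 ≤ N →
        lorentzNorm P p (rieszSum m ((p - 1) / p) F N) ≤
          C * ⨆ n, eLpNorm (F n) 1 P := by
  have : NeZero m := ⟨by omega⟩
  have hU : IsUniform m P := hPcyl
  have hm0 : (m : ℝ≥0∞) ≠ 0 := by exact_mod_cast NeZero.ne m
  have hmt : (m : ℝ≥0∞) ≠ ⊤ := ENNReal.natCast_ne_top m
  have hmR : (0 : ℝ) < m := by exact_mod_cast NeZero.pos m
  obtain ⟨ρ, hρ1, hρ⟩ := hW.exists_lt_one (by omega) hWV
  obtain ⟨q, hq, hqp⟩ : ∃ q, 1 < q ∧ q < p := exists_between hp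
  have hq0 : 0 < q := by linarith
  have hp0 : 0 < p := by linarith
  set θ : ℝ≥0 := ρ ^ (1 - 1 / q) with hθ
  have hexp : 0 < 1 - 1 / q := by rw [sub_pos, div_lt_one hq0]; exact hq
  have hθ1 : θ < 1 := NNReal.rpow_lt_one hρ1 hexp
  set κ : ℝ≥0 := (1 - θ)⁻¹ with hκdef
  have hκ : 1 + (κ : ℝ≥0∞) * (ρ : ℝ≥0∞) ^ (1 - 1 / q) ≤ κ := by
    rw [← ENNReal.coe_rpow_of_nonneg _ hexp.le]
    have h1 : (1 - θ) * κ = 1 := mul_inv_cancel₀ (tsub_pos_of_lt hθ1).ne'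
    have h2 : 1 + κ * θ = κ := by
      calc 1 + κ * θ = (1 - θ) * κ + θ * κ := by rw [h1, mul_comm κ]
        _ = (1 - θ + θ) * κ := by ring
        _ = κ := by rw [tsub_add_cancel_of_le hθ1.le, one_mul]
    exact_mod_cast h2.le
  set α : ℝ := (p - 1) / p with hα
  have hα0 : 0 ≤ α := by rw [hα]; exact div_nonneg (by linarith) hp0.le
  refine ⟨p.toNNReal * ((1 - q / p)⁻¹.toNNReal * (2 * κ)), fun F hF _ hFW N hN => ?_⟩
  have hdep : ∀ n, DependsOnFirst m n (F n) := hF.1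
  set u : ℕ → (ℕ → Fin m) → ℝ≥0∞ := fun n x => ‖F n x‖ₑ with hu
  have hu_dep : ∀ n, DependsOnFirst m n (u n) := fun n => (hdep n).comp fun a => ‖a‖ₑ
  have hsub : ∀ n x, u n x ≤ childAverage m n (u (n + 1)) x := by
    intro n x
    have h1 : (m : ℝ≥0∞) * ‖F n x‖ₑ ≤ ∑ j, ‖F (n + 1) (Function.update x n j)‖ₑ := by
      refine le_trans (le_of_eq ?_) (enorm_sum_le _ _)
      rw [← hF.2 n x, enorm_smul]
      simp
    calc u n x = (m : ℝ≥0∞)⁻¹ * (m * ‖F n x‖ₑ) := by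
          rw [← mul_assoc, ENNReal.inv_mul_cancel hm0 hmt, one_mul]
      _ ≤ _ := by
          rw [childAverage]
          gcongr
  have hspread : ∀ n x j, u (n + 1) (Function.update x n j) ≤
      ρ * ∑ i, u (n + 1) (Function.update x n i) := fun n x j =>
    hρ (F n x) (fun j => F (n + 1) (Function.update x n j)) (hFW n x) j
  have hsum := sum_normalized_Lq_le hU hu_dep hsub hspread hq hκ (N + 1)
  set h : ℕ → (ℕ → Fin m) → ℝ := fun n x => 2 * (m : ℝ) ^ (-(α * n)) * ‖F n x‖ with hh
  have hh_dep : ∀ n, DependsOnFirst m n (h n) := fun n =>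
    (hdep n).comp fun a => 2 * (m : ℝ) ^ (-(α * n)) * ‖a‖
  have hh0 : ∀ n, 0 ≤ h n := fun n x => by simp only [hh, Pi.zero_apply]; positivity
  have hR_dep : DependsOnFirst m N fun x => ‖rieszSum m α F N x‖ := by
    intro x y hxy
    simp only [rieszSum]
    refine congrArg _ (Finset.sum_congr rfl fun n hn => ?_)
    have hn' := (Finset.mem_Icc.1 hn).2
    rw [(hdep n).mono hn' x y hxy, (hdep (n - 1)).mono ((Nat.sub_le _ _).trans hn') x y hxy]
  have hle : ∀ x, ‖rieszSum m α F N x‖ ≤ ∑ n ∈ Finset.range (N + 1), h n x := by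
    intro x
    set e : ℕ → ℝ := fun n => (m : ℝ) ^ (-(α * n)) * ‖F n x‖ with he
    have he0 : ∀ n, 0 ≤ e n := fun n => by simp only [he]; positivity
    have hreindex : ∀ f : ℕ → EuclideanSpace ℝ (Fin l),
        ∑ n ∈ Finset.Icc 1 N, f n = ∑ n ∈ Finset.range N, f (n + 1) := fun f => by
      rw [Finset.range_eq_Ico, Finset.sum_Ico_add' f 0 N 1]
      rfl
    calc ‖rieszSum m α F N x‖ ≤ ∑ n ∈ Finset.range N, (e (n + 1) + e n) := by
          rw [rieszSum, hreindex]
          refine norm_sum_le_of_le _ fun n _ => ?_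
          rw [norm_smul, Real.norm_of_nonneg (by positivity), Nat.add_sub_cancel]
          refine (mul_le_mul_of_nonneg_left (norm_sub_le _ _) (by positivity)).trans ?_
          rw [mul_add]
          refine add_le_add le_rfl ?_
          refine mul_le_mul_of_nonneg_right ?_ (norm_nonneg _)
          refine Real.rpow_le_rpow_of_exponent_le (by exact_mod_cast NeZero.one_le) ?_
          push_cast
          nlinarith
      _ ≤ ∑ n ∈ Finset.range (N + 1), e n + ∑ n ∈ Finset.range (N + 1), e n := by
          rw [Finset.sum_add_distrib]
          refine add_le_add ?_ ?_
          · rw [Finset.sum_range_succ' e]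
            exact le_add_of_nonneg_right (he0 0)
          · rw [Finset.sum_range_succ e]
            exact le_add_of_nonneg_right (he0 N)
      _ = ∑ n ∈ Finset.range (N + 1), h n x := by
          rw [← two_mul, Finset.mul_sum]
          exact Finset.sum_congr rfl fun n _ => by simp only [he, hh]; ring
  have hterm : ∀ n, lorentzNorm P p (h n) ≤ ENNReal.ofReal (1 - q / p)⁻¹ *
      (2 * ((m : ℝ≥0∞) ^ (-((n : ℝ) * (1 - 1 / q))) * (∫⁻ x, u n x ^ q ∂P) ^ (1 / q))) := by
    intro n
    refine (lorentzNorm_le_of_dependsOnFirst hU (hh_dep n) hq0 hqp).trans (le_of_eq ?_)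
    congr 1
    have h1 : ∀ x, ‖h n x‖ₑ ^ q = (2 * (m : ℝ≥0∞) ^ (-(α * n))) ^ q * u n x ^ q := by
      intro x
      rw [← ENNReal.mul_rpow_of_nonneg _ _ hq0.le]
      congr 1
      simp only [hh, hu, enorm_mul, enorm_norm]
      congr 2
      · simp [Real.enorm_eq_ofReal]
      · rw [Real.enorm_eq_ofReal (by positivity), ← ENNReal.ofReal_rpow_of_pos hmR,
          ENNReal.ofReal_natCast]
    have h2 : (m : ℝ≥0∞) ^ ((n : ℝ) * (1 / q - 1 / p)) * (m : ℝ≥0∞) ^ (-(α * n)) =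
        (m : ℝ≥0∞) ^ (-((n : ℝ) * (1 - 1 / q))) := by
      rw [← ENNReal.rpow_add _ _ hm0 hmt, hα]
      congr 1
      field_simp
      ring
    rw [lintegral_congr h1, lintegral_const_mul _ ((hu_dep n).comp fun t => t ^ q).measurable,
      ENNReal.mul_rpow_of_nonneg _ _ (by positivity), ← ENNReal.rpow_mul,
      mul_one_div_cancel hq0.ne', ENNReal.rpow_one, ← h2]
    ring
  calc lorentzNorm P p (rieszSum m α F N)
      ≤ ENNReal.ofReal p * ∑ n ∈ Finset.range (N + 1), lorentzNorm P p (h n) :=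
        lorentzNorm_le_sum P hR_dep.measurable hR_dep.finite_range
          (measureReal_superlevel_pos hU hR_dep) hp _ h (fun n _ => (hh_dep n).measurable)
          (fun n _ => hh0 n) hle
    _ ≤ ENNReal.ofReal p * ∑ n ∈ Finset.range (N + 1), ENNReal.ofReal (1 - q / p)⁻¹ *
        (2 * ((m : ℝ≥0∞) ^ (-((n : ℝ) * (1 - 1 / q))) * (∫⁻ x, u n x ^ q ∂P) ^ (1 / q))) := by
        gcongr with n _
        exact hterm n
    _ ≤ ENNReal.ofReal p * (ENNReal.ofReal (1 - q / p)⁻¹ * (2 * (κ * ∫⁻ x, u (N + 1) x ∂P))) := by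
        rw [← Finset.mul_sum, ← Finset.mul_sum]
        gcongr
    _ = (p.toNNReal * ((1 - q / p)⁻¹.toNNReal * (2 * κ)) : ℝ≥0) * eLpNorm (F (N + 1)) 1 P := by
        rw [eLpNorm_one_eq_lintegral_enorm]
        push_cast
        simp only [ENNReal.ofReal]
        ring
    _ ≤ _ := by
        gcongr
        exact le_iSup (fun n => eLpNorm (F n) 1 P) (N + 1)
end
end

section
/- Main inequality: suppose W satisfies the second structural condition and let p ∈ (1,∞). Then there is a constant C = C(m,ℓ,W,p) such that every F ∈ 𝔚 satisfies Σ_{n=1}^∞ m^{−((p−1)/p)·n}·‖f_n‖_{L_{p,1}(P)} ≤ C·‖F‖_{L_1}, where ‖f_n‖_{L_{p,1}(P)} is the Lorentz quasinorm of the scalar function x ↦ ‖f_n(x)‖ (Euclidean norm on ℝ^ℓ). -/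
open MeasureTheory ENNReal NNReal

noncomputable section

open MartingaleModel

namespace MartingaleModel

open Finset in
/-- The `ℓ_q` norm of a nonnegative finite family is at most its sum. -/
theorem rpow_sum_rpow_le_sum {ι : Type*} (s : Finset ι) {q : ℝ} (hq : 1 ≤ q) (g : ι → ℝ)
    (hg : ∀ i, 0 ≤ g i) : (∑ i ∈ s, g i ^ q) ^ (1 / q) ≤ ∑ i ∈ s, g i := by
  have hq0 : 0 < q := by linarith
  have hS : 0 ≤ ∑ i ∈ s, g i := sum_nonneg fun i _ => hg i
  have hsplit : ∀ x : ℝ, 0 ≤ x → x ^ q = x ^ (q - 1) * x := fun x hx => by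
    conv_rhs => rw [← Real.rpow_one x, ← Real.rpow_mul hx, one_mul]
    rw [← Real.rpow_add_of_nonneg hx (by linarith) zero_le_one, sub_add_cancel]
  rw [one_div, Real.rpow_inv_le_iff_of_pos (sum_nonneg fun i _ => Real.rpow_nonneg (hg i) _) hS hq0,
    hsplit _ hS, mul_sum]
  refine sum_le_sum fun i hi => ?_
  rw [hsplit _ (hg i)]
  exact mul_le_mul_of_nonneg_right (Real.rpow_le_rpow (hg i)
    (single_le_sum (fun i _ => hg i) hi) (by linarith)) (hg i)

open Finset in
/-- If no entry carries more than `S - η e` of the total `S`, then the `ℓ_q` norm of a nonnegative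
family contracts `e`, up to the excess `S - e`. -/
theorem rpow_sum_rpow_le_contract {ι : Type*} [Fintype ι] [Nonempty ι] {q η e : ℝ} (hq : 1 ≤ q)
    (h : ι → ℝ) (h0 : ∀ i, 0 ≤ h i) (hη : ∀ i, h i ≤ ∑ j, h j - η * e) :
    (∑ i, h i ^ q) ^ (1 / q) ≤ (1 - (1 - 1 / q) * η) * e + (∑ j, h j - e) := by
  have hq0 : 0 < q := by linarith
  have hS : 0 ≤ ∑ i, h i := sum_nonneg fun i _ => h0 i
  set S := ∑ i, h i with hSdef
  set M := S - η * e with hM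
  have hM0 : 0 ≤ M := (h0 _).trans (hη (Classical.arbitrary ι))
  have h1 : ∑ i, h i ^ q ≤ S * M ^ (q - 1) := by
    rw [hSdef, sum_mul]
    refine sum_le_sum fun i _ => ?_
    calc h i ^ q = h i * h i ^ (q - 1) := by
          conv_rhs => enter [1]; rw [← Real.rpow_one (h i)]
          rw [← Real.rpow_add_of_nonneg (h0 i) zero_le_one (by linarith)]
          congr 1
          ring
      _ ≤ h i * M ^ (q - 1) :=
          mul_le_mul_of_nonneg_left (Real.rpow_le_rpow (h0 i) (hη i) (by linarith)) (h0 i)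
  have hq1 : 0 ≤ 1 - 1 / q := by
    rw [sub_nonneg, div_le_one hq0]
    exact hq
  calc (∑ i, h i ^ q) ^ (1 / q) ≤ (S * M ^ (q - 1)) ^ (1 / q) :=
        Real.rpow_le_rpow (sum_nonneg fun i _ => Real.rpow_nonneg (h0 i) _) h1 (by positivity)
    _ = S ^ (1 / q) * M ^ (1 - 1 / q) := by
        rw [Real.mul_rpow hS (Real.rpow_nonneg hM0 _), ← Real.rpow_mul hM0]
        congr 2
        field_simp
    _ ≤ (1 / q) * S + (1 - 1 / q) * M :=
        Real.geom_mean_le_arith_mean2_weighted (by positivity) hq1 hS hM0 (by ring)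
    _ = _ := by rw [hM]; ring

open Finset in
/-- Minkowski's inequality combined with `ℓ_1 ⊆ ℓ_q`, for a blockwise bound. -/
theorem rpow_sum_sum_rpow_le {ι κ : Type*} [Fintype ι] [Fintype κ] {q c : ℝ} (hq : 1 ≤ q)
    (hc : 0 ≤ c) (h : ι → κ → ℝ) (h0 : ∀ i j, 0 ≤ h i j) (a g : ι → ℝ) (ha : ∀ i, 0 ≤ a i)
    (hg : ∀ i, 0 ≤ g i) (hle : ∀ i, (∑ j, h i j ^ q) ^ (1 / q) ≤ c * a i + g i) :
    (∑ i, ∑ j, h i j ^ q) ^ (1 / q) ≤ c * (∑ i, a i ^ q) ^ (1 / q) + ∑ i, g i := by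
  have hq0 : 0 < q := by linarith
  have hblock : ∀ i, ∑ j, h i j ^ q ≤ (c * a i + g i) ^ q := fun i => by
    have := hle i
    rwa [one_div, Real.rpow_inv_le_iff_of_pos (sum_nonneg fun j _ => Real.rpow_nonneg (h0 i j) _)
      (add_nonneg (mul_nonneg hc (ha i)) (hg i)) hq0] at this
  calc (∑ i, ∑ j, h i j ^ q) ^ (1 / q) ≤ (∑ i, (c * a i + g i) ^ q) ^ (1 / q) :=
        Real.rpow_le_rpow
          (sum_nonneg fun i _ => sum_nonneg fun j _ => Real.rpow_nonneg (h0 i j) _)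
          (sum_le_sum fun i _ => hblock i) (by positivity)
    _ ≤ (∑ i, (c * a i) ^ q) ^ (1 / q) + (∑ i, g i ^ q) ^ (1 / q) :=
        Real.Lp_add_le_of_nonneg univ hq (fun i _ => mul_nonneg hc (ha i)) fun i _ => hg i
    _ ≤ c * (∑ i, a i ^ q) ^ (1 / q) + ∑ i, g i := by
        refine add_le_add (le_of_eq ?_) (rpow_sum_rpow_le_sum univ hq g hg)
        simp_rw [Real.mul_rpow hc (ha _), ← mul_sum]
        rw [Real.mul_rpow (Real.rpow_nonneg hc _)
            (sum_nonneg fun i _ => Real.rpow_nonneg (ha i) _), ← Real.rpow_mul hc,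
          mul_one_div_cancel hq0.ne', Real.rpow_one]

open Finset in
/-- Under the second structural condition, the values off any given child control the average. -/
theorem SecondStructural.exists_le_sum_erase {m l : ℕ} (hm : 2 ≤ m)
    {W : Submodule ℝ (Fin m → EuclideanSpace ℝ (Fin l))} (hWV : ∀ b ∈ W, ∑ j : Fin m, b j = 0) (hW : SecondStructural m l W) :
    ∃ η : ℝ, 0 < η ∧ η ≤ 1 ∧ ∀ b ∈ W, ∀ (a : EuclideanSpace ℝ (Fin l)) (j₀ : Fin m),
      η * ‖a‖ ≤ (∑ j ∈ univ.erase j₀, ‖a + b j‖) / m := by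
  have key : ∀ j₀ : Fin m, ∃ K : ℝ, 0 < K ∧ ∀ b ∈ W, ∀ a : EuclideanSpace ℝ (Fin l),
      ‖a‖ ≤ K * ∑ j ∈ univ.erase j₀, ‖a + b j‖ := by
    intro j₀
    let T : EuclideanSpace ℝ (Fin l) × W →ₗ[ℝ] ({j // j ≠ j₀} → EuclideanSpace ℝ (Fin l)) :=
      { toFun := fun x j => x.1 + (x.2 : Fin m → EuclideanSpace ℝ (Fin l)) j
        map_add' := fun x y => by ext1 j; simp; abel
        map_smul' := fun c x => by ext1 j; simp }
    have hT : LinearMap.ker T = ⊥ := by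
      rw [LinearMap.ker_eq_bot']
      rintro ⟨a, b, hb⟩ hab
      have hbj : ∀ j, j ≠ j₀ → b j = -a := fun j hj =>
        eq_neg_of_add_eq_zero_right (congrFun hab ⟨j, hj⟩)
      have hsum : b j₀ = ((m : ℝ) - 1) • a := by
        have h := hWV b hb
        rw [← add_sum_erase _ _ (mem_univ j₀),
          sum_congr rfl fun j hj => hbj j (ne_of_mem_erase hj), sum_const, card_erase_of_mem
          (mem_univ _), card_univ, Fintype.card_fin, smul_neg, ← sub_eq_add_neg, sub_eq_zero] at h
        rw [h, ← Nat.cast_smul_eq_nsmul ℝ, Nat.cast_sub (by omega), Nat.cast_one]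
      have hb_eq : b = fun j => (if j = j₀ then 1 - (m : ℝ) else 1) • -a := by
        funext j
        split_ifs with hj
        · rw [hj, hsum, smul_neg, ← neg_smul, neg_sub]
        · rw [hbj j hj, one_smul]
      have hb0 : b = 0 := by
        rw [hb_eq]
        refine hW _ _ ?_ ⟨j₀, 1, fun j hj => if_neg hj⟩ (hb_eq ▸ hb)
        rw [← add_sum_erase _ _ (mem_univ j₀),
          sum_congr rfl fun j hj => if_neg (ne_of_mem_erase hj)]
        simp [card_erase_of_mem, Nat.cast_sub (by omega : 1 ≤ m)]
      have ha0 : a = 0 := by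
        have : Nontrivial (Fin m) := Fin.nontrivial_iff_two_le.2 hm
        obtain ⟨j, hj⟩ := exists_ne j₀
        simpa [hb0] using hbj j hj
      simp [ha0, hb0]
    obtain ⟨K, hK, hTK⟩ := T.exists_antilipschitzWith hT
    refine ⟨K, by exact_mod_cast hK, fun b hb a => ?_⟩
    have h1 := ZeroHomClass.bound_of_antilipschitz T hTK (a, ⟨b, hb⟩)
    refine (norm_fst_le (a, (⟨b, hb⟩ : W))).trans (h1.trans ?_)
    refine mul_le_mul_of_nonneg_left ?_ K.2
    refine (pi_norm_le_iff_of_nonneg (sum_nonneg fun _ _ => norm_nonneg _)).2 fun j => ?_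
    exact single_le_sum (f := fun j => ‖a + b j‖) (fun _ _ => norm_nonneg _)
      (mem_erase.2 ⟨j.2, mem_univ _⟩)
  choose K hK hKle using key
  have hm0 : (0 : ℝ) < m := by exact_mod_cast (by omega : 0 < m)
  have hS : 0 ≤ ∑ j, K j := sum_nonneg fun j _ => (hK j).le
  refine ⟨1 / (1 + m * ∑ j, K j), by positivity, ?_, fun b hb a j₀ => ?_⟩
  · rw [div_le_one (by positivity)]
    have := mul_nonneg hm0.le hS
    linarith
  · rw [one_div_mul_eq_div, div_le_div_iff₀ (by positivity) hm0]
    have h0 : 0 ≤ ∑ j ∈ univ.erase j₀, ‖a + b j‖ := sum_nonneg fun _ _ => norm_nonneg _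
    have h1 : K j₀ ≤ ∑ j, K j := single_le_sum (fun j _ => (hK j).le) (mem_univ j₀)
    have h2 := (hKle j₀ b hb a).trans (mul_le_mul_of_nonneg_right h1 h0)
    nlinarith [mul_le_mul_of_nonneg_right h2 hm0.le]

/-- The infinite sequence that begins with the word `w` and continues with the letter `c`. -/
def padWord {m n : ℕ} (c : Fin m) (w : Fin n → Fin m) : ℕ → Fin m :=
  fun i => if h : i < n then w ⟨i, h⟩ else c

theorem padWord_snoc {m n : ℕ} (c : Fin m) (w : Fin n → Fin m) (j : Fin m) :
    padWord c (Fin.snoc w j : Fin (n + 1) → Fin m) = Function.update (padWord c w) n j := by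
  funext i
  rcases lt_trichotomy i n with h | h | h
  · simp [padWord, Function.update_of_ne h.ne, h, Nat.lt_succ_of_lt h, Fin.snoc]
  · subst h
    simp [padWord, Fin.snoc]
  · simp [padWord, Function.update_of_ne h.ne', h.not_gt, show ¬ i < n + 1 by omega]

theorem AdaptedFun.apply_eq_padWord {m : ℕ} {E : Type*} {F : ℕ → (ℕ → Fin m) → E}
    (hF : AdaptedFun m F) (c : Fin m) (n : ℕ) (x : ℕ → Fin m) :
    F n x = F n (padWord c fun i : Fin n => x i) :=
  hF n _ _ fun i hi => by simp [padWord, hi]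

theorem sum_word_succ {m n : ℕ} {R : Type*} [AddCommMonoid R] (φ : (Fin (n + 1) → Fin m) → R) :
    ∑ w, φ w = ∑ w : Fin n → Fin m, ∑ j : Fin m, φ (Fin.snoc w j) := by
  rw [← (Fin.snocEquiv fun _ : Fin (n + 1) => Fin m).sum_comp, Fintype.sum_prod_type_right]
  rfl

/-- Integration of a function of the first `n` letters. -/
theorem lintegral_word {m : ℕ} {P : Measure (ℕ → Fin m)}
    (hPcyl : ∀ (n : ℕ) (w : Fin n → Fin m), P (cyl m n w) = ((m : ℝ≥0∞))⁻¹ ^ n)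
    (n : ℕ) (φ : (Fin n → Fin m) → ℝ≥0∞) :
    ∫⁻ x, φ (fun i => x i) ∂P = ∑ w, φ w * ((m : ℝ≥0∞))⁻¹ ^ n := by
  have hmeas : Measurable fun (x : ℕ → Fin m) (i : Fin n) => x i := by fun_prop
  rw [← lintegral_map (measurable_of_finite φ) hmeas, lintegral_fintype]
  refine Finset.sum_congr rfl fun w _ => ?_
  rw [Measure.map_apply hmeas (measurableSet_singleton w), ← hPcyl n w]
  congr 2
  ext x
  simp [cyl, funext_iff]

/-- A weak-type `q` bound together with a uniform bound controls the `L_{p,1}` quasinorm for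
`q < p`. -/
theorem lorentzNorm_le_of_weak {X E : Type*} [MeasurableSpace X] [NormedAddCommGroup E]
    {μ : Measure X} {p q K R : ℝ} (hp : 0 < p) (hqp : q < p) (hK : 0 ≤ K) (hR : 0 ≤ R) (g : X → E)
    (hgR : ∀ x, ‖g x‖ ≤ R) (hweak : ∀ t, 0 < t → μ {x | t < ‖g x‖} ≤ ENNReal.ofReal (K * t ^ (-q))) :
    lorentzNorm μ p g ≤ ENNReal.ofReal (K ^ (1 / p) * R ^ (1 - q / p) / (1 - q / p)) := by
  have hqp' : q / p < 1 := (div_lt_one hp).2 hqp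
  have hint : IntervalIntegrable (fun t : ℝ => K ^ (1 / p) * t ^ (-(q / p))) volume 0 R :=
    (intervalIntegral.intervalIntegrable_rpow' (by linarith)).const_mul _
  rw [intervalIntegrable_iff_integrableOn_Ioc_of_le hR] at hint
  have hval : ∫ t in Set.Ioc 0 R, K ^ (1 / p) * t ^ (-(q / p)) =
      K ^ (1 / p) * R ^ (1 - q / p) / (1 - q / p) := by
    rw [← intervalIntegral.integral_of_le hR, intervalIntegral.integral_const_mul,
      integral_rpow (Or.inl (by linarith)), Real.zero_rpow (by linarith)]
    rw [sub_zero, mul_div_assoc, neg_add_eq_sub]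
  rw [← hval, ofReal_integral_eq_lintegral_ofReal hint]
  · rw [lorentzNorm, ← lintegral_indicator measurableSet_Ioi,
      ← lintegral_indicator measurableSet_Ioc]
    refine lintegral_mono fun t => ?_
    by_cases ht : 0 < t
    · rw [Set.indicator_of_mem (Set.mem_Ioi.2 ht)]
      by_cases htR : t ≤ R
      · rw [Set.indicator_of_mem (Set.mem_Ioc.2 ⟨ht, htR⟩)]
        calc (μ {x | t < ‖g x‖}) ^ (1 / p) ≤ (ENNReal.ofReal (K * t ^ (-q))) ^ (1 / p) :=
              ENNReal.rpow_le_rpow (hweak t ht) (by positivity)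
          _ = ENNReal.ofReal (K ^ (1 / p) * t ^ (-(q / p))) := by
              rw [ENNReal.ofReal_rpow_of_nonneg (by positivity) (by positivity),
                Real.mul_rpow hK (by positivity), ← Real.rpow_mul ht.le]
              congr 3
              ring
      · have : {x | t < ‖g x‖} = ∅ := by
          ext x
          simpa using (hgR x).trans (not_le.1 htR).le
        rw [this, measure_empty, ENNReal.zero_rpow_of_pos (by positivity)]
        exact zero_le
    · rw [Set.indicator_of_notMem (by simpa using ht)]
      exact zero_le
  · filter_upwards [ae_restrict_mem measurableSet_Ioc] with t ht
    have := ht.1.le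
    positivity

/-- On functions of the first `n` letters, the suitably rescaled `ℓ_q` norm dominates the
`L_{p,1}` quasinorm for `q < p`. -/
theorem lorentzNorm_word_le {m : ℕ} (hm : 0 < m) {P : Measure (ℕ → Fin m)}
    (hPcyl : ∀ (n : ℕ) (w : Fin n → Fin m), P (cyl m n w) = ((m : ℝ≥0∞))⁻¹ ^ n)
    {E : Type*} [NormedAddCommGroup E] {p q : ℝ} (hq : 0 < q) (hqp : q < p) (n : ℕ)
    (g : (Fin n → Fin m) → E) :
    lorentzNorm P p (fun x => g fun i => x i) ≤
      ENNReal.ofReal ((1 - q / p)⁻¹ * ((m : ℝ) ^ n) ^ (1 - 1 / p) *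
        (∑ w, (‖g w‖ / (m : ℝ) ^ n) ^ q) ^ (1 / q)) := by
  have hp : 0 < p := hq.trans hqp
  have hqp' : q / p < 1 := (div_lt_one hp).2 hqp
  have hm0 : (0 : ℝ) < m := by exact_mod_cast hm
  set N : ℝ := (m : ℝ) ^ n with hN
  have hN0 : 0 < N := by positivity
  set Q : ℝ := ∑ w, (‖g w‖ / N) ^ q with hQ
  have hQ0 : 0 ≤ Q := Finset.sum_nonneg fun w _ => by positivity
  set A := Q ^ (1 / q) with hA
  have hA0 : 0 ≤ A := by positivity
  have hAq : A ^ q = Q := by rw [hA, ← Real.rpow_mul hQ0, one_div_mul_cancel hq.ne', Real.rpow_one]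
  have hbound : ∀ w, ‖g w‖ ≤ N * A := fun w => by
    rw [← div_le_iff₀' hN0, hA, one_div, Real.le_rpow_inv_iff_of_pos (by positivity) hQ0 hq]
    exact Finset.single_le_sum (f := fun w => (‖g w‖ / N) ^ q) (fun w _ => by positivity)
      (Finset.mem_univ w)
  have hmN : ((m : ℝ≥0∞))⁻¹ ^ n = ENNReal.ofReal N⁻¹ := by
    rw [ENNReal.ofReal_inv_of_pos hN0, hN, ENNReal.ofReal_pow hm0.le, ENNReal.ofReal_natCast,
      ENNReal.inv_pow]
  have hweak : ∀ t, 0 < t → P {x | t < ‖g fun i => x i‖} ≤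
      ENNReal.ofReal (Q * N ^ (q - 1) * t ^ (-q)) := by
    intro t ht
    have hset : P {x | t < ‖g fun i => x i‖} ≤
        ∫⁻ x, ENNReal.ofReal ((‖g fun i : Fin n => x i‖ / t) ^ q) ∂P := by
      have hmeas : Measurable fun x : ℕ → Fin m =>
          ENNReal.ofReal ((‖g fun i : Fin n => x i‖ / t) ^ q) :=
        (measurable_of_finite fun w : Fin n → Fin m => ENNReal.ofReal ((‖g w‖ / t) ^ q)).comp
          (by fun_prop : Measurable fun (x : ℕ → Fin m) (i : Fin n) => x i)
      have h1 := mul_meas_ge_le_lintegral hmeas (μ := P) 1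
      rw [one_mul] at h1
      refine (measure_mono fun x hx => ?_).trans h1
      exact ENNReal.one_le_ofReal.2
        (Real.one_le_rpow ((one_le_div ht).2 (le_of_lt hx)) hq.le)
    refine hset.trans (le_of_eq ?_)
    rw [lintegral_word hPcyl n fun w => ENNReal.ofReal ((‖g w‖ / t) ^ q), hmN]
    simp_rw [← ENNReal.ofReal_mul (Real.rpow_nonneg (div_nonneg (norm_nonneg _) ht.le) q)]
    rw [← ENNReal.ofReal_sum_of_nonneg fun w _ => by positivity, hQ, Finset.sum_mul,
      Finset.sum_mul]
    congr 1
    refine Finset.sum_congr rfl fun w _ => ?_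
    rw [Real.div_rpow (norm_nonneg _) ht.le, Real.div_rpow (norm_nonneg _) hN0.le,
      Real.rpow_sub_one hN0.ne', Real.rpow_neg ht.le]
    have := Real.rpow_pos_of_pos hN0 q
    field_simp
  refine (lorentzNorm_le_of_weak hp hqp (by positivity) (by positivity) _
    (fun x => hbound _) hweak).trans (le_of_eq ?_)
  congr 1
  rw [← hAq, Real.mul_rpow (by positivity) (by positivity), ← Real.rpow_mul hA0,
    ← Real.rpow_mul hN0.le, Real.mul_rpow hN0.le hA0, mul_one_div]
  have e1 : A ^ (q / p) * A ^ (1 - q / p) = A := by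
    rw [← Real.rpow_add_of_nonneg hA0 (by positivity) (by linarith), add_sub_cancel, Real.rpow_one]
  have e2 : N ^ ((q - 1) * (1 / p)) * N ^ (1 - q / p) = N ^ (1 - 1 / p) := by
    rw [← Real.rpow_add hN0]
    congr 1
    ring
  calc _ = (1 - q / p)⁻¹ * (N ^ ((q - 1) * (1 / p)) * N ^ (1 - q / p)) *
        (A ^ (q / p) * A ^ (1 - q / p)) := by ring
    _ = _ := by rw [e1, e2]

/-- The rescaled `ℓ_q` norm on words of length `n` of the `n`-th term of a process. -/
def wordNorm {m : ℕ} {E : Type*} [NormedAddCommGroup E] (q : ℝ) (c : Fin m)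
    (G : (ℕ → Fin m) → E) (n : ℕ) : ℝ :=
  (∑ w : Fin n → Fin m, (‖G (padWord c w)‖ / (m : ℝ) ^ n) ^ q) ^ (1 / q)

theorem wordNorm_nonneg {m : ℕ} {E : Type*} [NormedAddCommGroup E] (q : ℝ) (c : Fin m)
    (G : (ℕ → Fin m) → E) (n : ℕ) : 0 ≤ wordNorm q c G n :=
  Real.rpow_nonneg (Finset.sum_nonneg fun _ _ => by positivity) _

theorem wordNorm_one {m : ℕ} {E : Type*} [NormedAddCommGroup E] (c : Fin m)
    (G : (ℕ → Fin m) → E) (n : ℕ) :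
    wordNorm 1 c G n = ∑ w : Fin n → Fin m, ‖G (padWord c w)‖ / (m : ℝ) ^ n := by
  simp [wordNorm]

theorem eLpNorm_one_eq_wordNorm {m : ℕ} (hm : 0 < m) {P : Measure (ℕ → Fin m)}
    (hPcyl : ∀ (n : ℕ) (w : Fin n → Fin m), P (cyl m n w) = ((m : ℝ≥0∞))⁻¹ ^ n)
    {E : Type*} [NormedAddCommGroup E] {F : ℕ → (ℕ → Fin m) → E} (hF : AdaptedFun m F)
    (c : Fin m) (n : ℕ) : eLpNorm (F n) 1 P = ENNReal.ofReal (wordNorm 1 c (F n) n) := by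
  have hm0 : (0 : ℝ) < m := by exact_mod_cast hm
  have hmN : ((m : ℝ≥0∞))⁻¹ ^ n = ENNReal.ofReal ((m : ℝ) ^ n)⁻¹ := by
    rw [ENNReal.ofReal_inv_of_pos (by positivity), ENNReal.ofReal_pow hm0.le,
      ENNReal.ofReal_natCast, ENNReal.inv_pow]
  rw [eLpNorm_one_eq_lintegral_enorm, wordNorm_one]
  rw [lintegral_congr fun x => congrArg enorm (hF.apply_eq_padWord c n x)]
  rw [lintegral_word hPcyl n fun w => ‖F n (padWord c w)‖ₑ, hmN,
    ENNReal.ofReal_sum_of_nonneg fun _ _ => by positivity]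
  refine Finset.sum_congr rfl fun w _ => ?_
  rw [div_eq_mul_inv, ENNReal.ofReal_mul (norm_nonneg _), ofReal_norm]

/-- The excess of the `L_1` norm of a martingale over one step, localised at a word. -/
def excess {m : ℕ} {E : Type*} [NormedAddCommGroup E] (c : Fin m)
    (F : ℕ → (ℕ → Fin m) → E) (n : ℕ) (w : Fin n → Fin m) : ℝ :=
  ∑ j : Fin m, ‖F (n + 1) (Function.update (padWord c w) n j)‖ / (m : ℝ) ^ (n + 1) -
    ‖F n (padWord c w)‖ / (m : ℝ) ^ n

theorem excess_nonneg {m : ℕ} (hm : 0 < m) {E : Type*} [NormedAddCommGroup E] [NormedSpace ℝ E]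
    {F : ℕ → (ℕ → Fin m) → E} (hF : IsMartingaleFun m F) (c : Fin m) (n : ℕ)
    (w : Fin n → Fin m) : 0 ≤ excess c F n w := by
  have hm0 : (0 : ℝ) < m := by exact_mod_cast hm
  have h := norm_sum_le Finset.univ fun j => F (n + 1) (Function.update (padWord c w) n j)
  rw [← hF.2 n (padWord c w), norm_smul, Real.norm_of_nonneg hm0.le] at h
  rw [excess, sub_nonneg, ← Finset.sum_div, pow_succ', ← div_div]
  gcongr
  rwa [le_div_iff₀' hm0]

theorem sum_excess {m : ℕ} {E : Type*} [NormedAddCommGroup E] (F : ℕ → (ℕ → Fin m) → E)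
    (c : Fin m) (n : ℕ) :
    ∑ w, excess c F n w = wordNorm 1 c (F (n + 1)) (n + 1) - wordNorm 1 c (F n) n := by
  simp_rw [excess, Finset.sum_sub_distrib, wordNorm_one, sum_word_succ, padWord_snoc]

/-- A blockwise bound of the children of each word by the word's value and its excess gives a
bound of the level norms. -/
theorem wordNorm_succ_le {m : ℕ} (hm : 0 < m) {E : Type*} [NormedAddCommGroup E]
    [NormedSpace ℝ E] {F : ℕ → (ℕ → Fin m) → E} (hF : IsMartingaleFun m F) {q κ : ℝ} (hq : 1 ≤ q)
    (hκ : 0 ≤ κ) (c : Fin m) (n : ℕ) (G : (ℕ → Fin m) → E)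
    (h : ∀ w : Fin n → Fin m,
      (∑ j, (‖G (Function.update (padWord c w) n j)‖ / (m : ℝ) ^ (n + 1)) ^ q) ^ (1 / q) ≤
        κ * (‖F n (padWord c w)‖ / (m : ℝ) ^ n) + excess c F n w) :
    wordNorm q c G (n + 1) ≤ κ * wordNorm q c (F n) n +
      (wordNorm 1 c (F (n + 1)) (n + 1) - wordNorm 1 c (F n) n) := by
  have := rpow_sum_sum_rpow_le hq hκ
    (fun (w : Fin n → Fin m) j => ‖G (Function.update (padWord c w) n j)‖ / (m : ℝ) ^ (n + 1))
    (fun _ _ => by positivity) (fun w => ‖F n (padWord c w)‖ / (m : ℝ) ^ n) (excess c F n)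
    (fun _ => by positivity) (excess_nonneg hm hF c n) h
  rw [sum_excess] at this
  refine le_trans (le_of_eq ?_) this
  rw [wordNorm, sum_word_succ]
  simp_rw [padWord_snoc]

theorem wordNorm_diff_le {m : ℕ} (hm : 0 < m) {E : Type*} [NormedAddCommGroup E]
    [NormedSpace ℝ E] {F : ℕ → (ℕ → Fin m) → E} (hF : IsMartingaleFun m F) {q : ℝ} (hq : 1 ≤ q)
    (c : Fin m) (n : ℕ) :
    wordNorm q c (fun x => F (n + 1) x - F n x) (n + 1) ≤ 2 * wordNorm q c (F n) n +
      (wordNorm 1 c (F (n + 1)) (n + 1) - wordNorm 1 c (F n) n) := by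
  have hm0 : (0 : ℝ) < m := by exact_mod_cast hm
  refine wordNorm_succ_le hm hF hq zero_le_two c n _ fun w => ?_
  refine (rpow_sum_rpow_le_sum Finset.univ hq _ fun j => by positivity).trans ?_
  have hadapt : ∀ j, F n (Function.update (padWord c w) n j) = F n (padWord c w) := fun j =>
    hF.1 n _ _ fun i hi => Function.update_of_ne hi.ne _ _
  have hconst : ∑ _j : Fin m, ‖F n (padWord c w)‖ / (m : ℝ) ^ (n + 1) =
      ‖F n (padWord c w)‖ / (m : ℝ) ^ n := by
    rw [Finset.sum_const, Finset.card_univ, Fintype.card_fin, nsmul_eq_mul, pow_succ]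
    field_simp
  have hle : ∑ j, ‖F (n + 1) (Function.update (padWord c w) n j) -
        F n (Function.update (padWord c w) n j)‖ / (m : ℝ) ^ (n + 1) ≤
      ∑ j, ‖F (n + 1) (Function.update (padWord c w) n j)‖ / (m : ℝ) ^ (n + 1) +
        ‖F n (padWord c w)‖ / (m : ℝ) ^ n := by
    rw [← hconst, ← Finset.sum_add_distrib]
    refine Finset.sum_le_sum fun j _ => ?_
    rw [hadapt, ← add_div]
    gcongr
    exact norm_sub_le _ _
  rw [excess]
  linarith

/-- Contraction of the level norms of a martingale in `𝔚`, up to the increment of the `L_1`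
norms. -/
theorem wordNorm_succ_le_contract {m l : ℕ} (hm : 0 < m)
    {W : Submodule ℝ (Fin m → EuclideanSpace ℝ (Fin l))} {q η : ℝ} (hq : 1 ≤ q) (hη0 : 0 ≤ η)
    (hη1 : η ≤ 1)
    (hη : ∀ b ∈ W, ∀ (a : EuclideanSpace ℝ (Fin l)) (j₀ : Fin m),
      η * ‖a‖ ≤ (∑ j ∈ Finset.univ.erase j₀, ‖a + b j‖) / m)
    {F : ℕ → (ℕ → Fin m) → EuclideanSpace ℝ (Fin l)} (hF : IsMartingaleFun m F)
    (hFW : MemW m l W F) (c : Fin m) (n : ℕ) :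
    wordNorm q c (F (n + 1)) (n + 1) ≤ (1 - (1 - 1 / q) * η) * wordNorm q c (F n) n +
      (wordNorm 1 c (F (n + 1)) (n + 1) - wordNorm 1 c (F n) n) := by
  have hm0 : (0 : ℝ) < m := by exact_mod_cast hm
  have : Nonempty (Fin m) := ⟨c⟩
  have hq0 : 0 < 1 / q := by positivity
  have hq1 : 1 / q ≤ 1 := by rwa [div_le_one (by linarith)]
  refine wordNorm_succ_le hm hF hq (by nlinarith) c n _ fun w => ?_
  refine rpow_sum_rpow_le_contract hq _ (fun j => by positivity) fun j₀ => ?_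
  have h := hη _ (hFW n (padWord c w)) (F n (padWord c w)) j₀
  simp only [diffTuple, add_sub_cancel] at h
  rw [← Finset.add_sum_erase _ _ (Finset.mem_univ j₀), add_sub_assoc, le_add_iff_nonneg_right,
    sub_nonneg, ← Finset.sum_div, pow_succ', ← div_div, mul_div_assoc']
  gcongr

theorem sum_wordNorm_diff_le {m l : ℕ} (hm : 0 < m)
    {W : Submodule ℝ (Fin m → EuclideanSpace ℝ (Fin l))} {q η : ℝ} (hq : 1 < q) (hη0 : 0 < η)
    (hη1 : η ≤ 1)
    (hη : ∀ b ∈ W, ∀ (a : EuclideanSpace ℝ (Fin l)) (j₀ : Fin m),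
      η * ‖a‖ ≤ (∑ j ∈ Finset.univ.erase j₀, ‖a + b j‖) / m)
    {F : ℕ → (ℕ → Fin m) → EuclideanSpace ℝ (Fin l)} (hF : IsMartingaleFun m F)
    (hFW : MemW m l W F) (c : Fin m) (N : ℕ) :
    ∑ n ∈ Finset.range N, wordNorm q c (fun x => F (n + 1) x - F n x) (n + 1) ≤
      (2 / ((1 - 1 / q) * η) + 1) * wordNorm 1 c (F N) N := by
  have hδ : 0 < (1 - 1 / q) * η :=
    mul_pos (by rw [sub_pos, div_lt_one (by linarith)]; exact hq) hη0
  set δ := (1 - 1 / q) * η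
  have hA : ∀ N, δ * ∑ n ∈ Finset.range N, wordNorm q c (F n) n + wordNorm q c (F N) N ≤
      wordNorm 1 c (F N) N := by
    intro N
    induction N with
    | zero =>
      have hq0 : q ≠ 0 := by linarith
      simp [wordNorm, ← Real.rpow_mul, hq0]
    | succ N ih =>
      have := wordNorm_succ_le_contract hm hq.le hη0.le hη1 hη hF hFW c N
      rw [Finset.sum_range_succ]
      linarith
  have hB : ∑ n ∈ Finset.range N, wordNorm q c (fun x => F (n + 1) x - F n x) (n + 1) ≤
      2 * ∑ n ∈ Finset.range N, wordNorm q c (F n) n +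
        (wordNorm 1 c (F N) N - wordNorm 1 c (F 0) 0) := by
    rw [← Finset.sum_range_sub (fun n => wordNorm 1 c (F n) n), Finset.mul_sum,
      ← Finset.sum_add_distrib]
    exact Finset.sum_le_sum fun n _ => wordNorm_diff_le hm hF hq.le c n
  have h0 := wordNorm_nonneg 1 c (F 0) 0
  have h1 : ∑ n ∈ Finset.range N, wordNorm q c (F n) n ≤ wordNorm 1 c (F N) N / δ := by
    rw [le_div_iff₀' hδ]
    linarith [hA N, wordNorm_nonneg q c (F N) N]
  calc _ ≤ 2 * (wordNorm 1 c (F N) N / δ) + wordNorm 1 c (F N) N := by linarith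
    _ = _ := by ring

end MartingaleModel

/-- **Main inequality.** If `W ⊆ V^ℓ` satisfies the second structural condition and
`p ∈ (1,∞)`, then there is `C = C(m,ℓ,W,p)` such that every `F ∈ 𝔚` satisfies
`∑_{n=1}^∞ m^{-((p-1)/p)n} ‖f_n‖_{L_{p,1}(P)} ≤ C·‖F‖_{L_1}`. -/
theorem martingale_main_inequality (m l : ℕ) (hm : 3 ≤ m) (hl : 1 ≤ l)
    (P : Measure (ℕ → Fin m)) (hP : IsProbabilityMeasure P)
    (hPcyl : ∀ (n : ℕ) (w : Fin n → Fin m), P (cyl m n w) = ((m : ℝ≥0∞))⁻¹ ^ n)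
    (W : Submodule ℝ (Fin m → EuclideanSpace ℝ (Fin l)))
    (hWV : ∀ b ∈ W, ∑ j : Fin m, b j = 0)
    (hW : SecondStructural m l W) (p : ℝ) (hp : 1 < p) :
    ∃ C : ℝ≥0, ∀ F : ℕ → (ℕ → Fin m) → EuclideanSpace ℝ (Fin l),
      IsMartingaleFun m F → (⨆ n, eLpNorm (F n) 1 P) < ⊤ → MemW m l W F →
      ∑' n : ℕ, ENNReal.ofReal ((m : ℝ) ^ (-(((p - 1) / p) * (n + 1 : ℕ)))) *
          lorentzNorm P p (fun x => F (n + 1) x - F n x) ≤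
        C * ⨆ n, eLpNorm (F n) 1 P := by
  have hm0 : 0 < m := by omega
  have hmR : (0 : ℝ) < m := by exact_mod_cast hm0
  obtain ⟨η, hη0, hη1, hη⟩ := hW.exists_le_sum_erase (by omega) hWV
  set q := (1 + p) / 2 with hqdef
  have hq : 1 < q := by rw [hqdef]; linarith
  have hqp : q < p := by rw [hqdef]; linarith
  have hqp' : 0 < 1 - q / p := sub_pos.2 ((div_lt_one (by linarith)).2 hqp)
  set D := (1 - q / p)⁻¹ * (2 / ((1 - 1 / q) * η) + 1) with hD
  refine ⟨D.toNNReal, fun F hF _ hFW => ?_⟩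
  let c : Fin m := ⟨0, hm0⟩
  have hterm : ∀ n : ℕ, ENNReal.ofReal ((m : ℝ) ^ (-(((p - 1) / p) * (n + 1 : ℕ)))) *
        lorentzNorm P p (fun x => F (n + 1) x - F n x) ≤
      ENNReal.ofReal ((1 - q / p)⁻¹ * wordNorm q c (fun x => F (n + 1) x - F n x) (n + 1)) := by
    intro n
    have hfun : (fun x => F (n + 1) x - F n x) = fun x =>
        (fun w : Fin (n + 1) → Fin m => F (n + 1) (padWord c w) - F n (padWord c w))
          fun i => x i := by
      funext x
      congr 1
      · exact hF.1.apply_eq_padWord c (n + 1) x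
      · exact hF.1 n _ _ fun i hi => by simp [padWord, Nat.lt_succ_of_lt hi]
    have h := lorentzNorm_word_le hm0 hPcyl (by linarith) hqp (n + 1)
      fun w : Fin (n + 1) → Fin m => F (n + 1) (padWord c w) - F n (padWord c w)
    rw [← hfun] at h
    refine (mul_le_mul_right h _).trans (le_of_eq ?_)
    rw [← ENNReal.ofReal_mul (by positivity)]
    congr 1
    have hcancel : (m : ℝ) ^ (-(((p - 1) / p) * (n + 1 : ℕ))) *
        ((m : ℝ) ^ (n + 1)) ^ (1 - 1 / p) = 1 := by
      rw [← Real.rpow_natCast, ← Real.rpow_mul hmR.le, ← Real.rpow_add hmR]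
      have hp0 : p ≠ 0 := by linarith
      rw [show -(((p - 1) / p) * ((n + 1 : ℕ) : ℝ)) + ((n + 1 : ℕ) : ℝ) * (1 - 1 / p) = 0 by
        field_simp; ring, Real.rpow_zero]
    rw [← mul_assoc, mul_left_comm, hcancel, mul_one, wordNorm]
  refine ENNReal.tsum_le_of_sum_range_le fun N => ?_
  calc _ ≤ ∑ n ∈ Finset.range N, ENNReal.ofReal
        ((1 - q / p)⁻¹ * wordNorm q c (fun x => F (n + 1) x - F n x) (n + 1)) :=
        Finset.sum_le_sum fun n _ => hterm n
    _ = ENNReal.ofReal ((1 - q / p)⁻¹ *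
        ∑ n ∈ Finset.range N, wordNorm q c (fun x => F (n + 1) x - F n x) (n + 1)) := by
        rw [Finset.mul_sum, ENNReal.ofReal_sum_of_nonneg fun n _ =>
          mul_nonneg (inv_nonneg.2 hqp'.le) (wordNorm_nonneg _ _ _ _)]
    _ ≤ ENNReal.ofReal (D * wordNorm 1 c (F N) N) := by
        rw [hD, mul_assoc]
        exact ENNReal.ofReal_le_ofReal (mul_le_mul_of_nonneg_left
          (sum_wordNorm_diff_le hm0 hq hη0 hη1 hη hF hFW c N) (inv_nonneg.2 hqp'.le))
    _ = D.toNNReal * eLpNorm (F N) 1 P := by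
        rw [ENNReal.ofReal_mul' (wordNorm_nonneg _ _ _ _), eLpNorm_one_eq_wordNorm hm0 hPcyl hF.1 c]
        rfl
    _ ≤ _ := mul_le_mul_right (le_iSup (fun n => eLpNorm (F n) 1 P) N) _
end
end
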